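/- arXiv:2510.19147 — 4 statements merged into one kernel-verified Lean document; each statement's English description precedes it below -/
import Mathlib

section
/- There is an infinite family (f_n)_{n∈ℕ} of Borel, injective, uniformly e-invariant functions f_n : P(ℕ) → P(ℕ) that forms an antichain under ≤_e^▽: for all m ≠ n, f_m ≰_e^▽ f_n. -/
open Classical

/-- The `e`-th computably enumerable subset of `ℕ` (the domain of the `e`-th
partial computable function). -/
def ceSet (e : ℕ) : Set ℕ :=
  {n | ((Denumerable.ofNat Nat.Partrec.Code e).eval n).Dom}

/-- The finite set canonically coded by `u` (via binary expansion). -/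
def finCode (u : ℕ) : Set ℕ := {n | Nat.testBit u n}

/-- The `i`-th enumeration operator applied to `B`. -/
def eOp (i : ℕ) (B : Set ℕ) : Set ℕ :=
  {n | ∃ u : ℕ, Nat.pair n u ∈ ceSet i ∧ finCode u ⊆ B}

/-- `A ≤ₑ B` via the index `i`. -/
def ELeVia (A B : Set ℕ) (i : ℕ) : Prop := A = eOp i B

/-- Enumeration reducibility. -/
def ELe (A B : Set ℕ) : Prop := ∃ i, ELeVia A B i

/-- `A ≡ₑ B` via the pair of indices `⟨i,j⟩`. -/
def EEquivVia (A B : Set ℕ) (i j : ℕ) : Prop := ELeVia A B i ∧ ELeVia B A j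

/-- Enumeration equivalence. -/
def EEquiv (A B : Set ℕ) : Prop := ELe A B ∧ ELe B A

/-- Strict enumeration reducibility. -/
def ELt (A B : Set ℕ) : Prop := ELe A B ∧ ¬ ELe B A

/-- The enumeration degree of `A`, i.e. its `≡ₑ`-class. -/
def edeg (A : Set ℕ) : Set (Set ℕ) := {B | EEquiv A B}

/-- `K_A = {⟨i,n⟩ : n ∈ Γ_i(A)}`. -/
def KSet (A : Set ℕ) : Set ℕ := {m | m.unpair.2 ∈ eOp m.unpair.1 A}

/-- The skip `A^⋄ = ℕ \ K_A`. -/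
def eSkip (A : Set ℕ) : Set ℕ := (KSet A)ᶜ

/-- `A ⊕ B = {2n : n ∈ A} ∪ {2n+1 : n ∈ B}`. -/
def eJoin (A B : Set ℕ) : Set ℕ :=
  {n | (∃ m ∈ A, n = 2 * m) ∨ (∃ m ∈ B, n = 2 * m + 1)}

/-- The enumeration jump `A' = K_A ⊕ (ℕ \ K_A)`. -/
def eJump (A : Set ℕ) : Set ℕ := eJoin (KSet A) (KSet A)ᶜ

/-- `u` is a uniformity function for `f` on the domain `D`. -/
def IsUniformityOn (D : Set (Set ℕ)) (f : Set ℕ → Set ℕ) (u : ℕ → ℕ) : Prop :=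
  ∀ A ∈ D, ∀ B ∈ D, ∀ i j : ℕ, EEquivVia A B i j →
    EEquivVia (f A) (f B) (u (Nat.pair i j)).unpair.1 (u (Nat.pair i j)).unpair.2

/-- `f` is uniformly e-invariant on the domain `D`. -/
def UniformlyEInvariantOn (D : Set (Set ℕ)) (f : Set ℕ → Set ℕ) : Prop :=
  ∃ u : ℕ → ℕ, IsUniformityOn D f u

/-- `f` is uniformly e-invariant. -/
def UniformlyEInvariant (f : Set ℕ → Set ℕ) : Prop :=
  UniformlyEInvariantOn Set.univ f

/-- `f` is e-invariant. -/
def EInvariant (f : Set ℕ → Set ℕ) : Prop :=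
  ∀ A B : Set ℕ, EEquiv A B → EEquiv (f A) (f B)

/-- `f ≤ₑ^▽ g`: `f` is e-below `g` on a cone. -/
def ConeLe (f g : Set ℕ → Set ℕ) : Prop :=
  ∃ D : Set ℕ, ∀ X : Set ℕ, ELe D X → ELe (f X) (g X)

/-- Borel functions on Cantor space `P(ℕ)`. -/
def BorelFun (F : Set ℕ → Set ℕ) : Prop := Measurable F

namespace AC

open Nat.Partrec (Code)

lemma ce_of_re {p : ℕ → Prop} (hp : REPred p) : ∃ e, ∀ n, n ∈ ceSet e ↔ p n := by
  have h : Partrec fun a : ℕ => (Part.assert (p a) fun _ => Part.some ()).map (fun _ => (0:ℕ)) :=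
    Partrec.map hp ((Computable.const 0).to₂)
  obtain ⟨c, hc⟩ := Nat.Partrec.Code.exists_code.1 (Partrec.nat_iff.1 h)
  refine ⟨Encodable.encode c, fun n => ?_⟩
  simp only [ceSet, Set.mem_ofPred_eq, Denumerable.ofNat_encode, hc]
  simp [Part.assert]

lemma re_of_ex {Q : ℕ → ℕ → Prop} (hQ : PrimrecRel Q) : REPred fun x => ∃ s, Q x s := by
  obtain ⟨inst, h⟩ := hQ
  have h0 : Computable₂ fun (x s : ℕ) => @decide (Q x s) (inst (x, s)) := h.to_comp
  have h2 := (Partrec.rfind h0.partrec₂).dom_re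
  refine h2.of_eq fun x => ?_
  refine Nat.rfind_dom.trans ?_
  constructor
  · rintro ⟨n, hn, -⟩
    refine ⟨n, ?_⟩
    have := Part.mem_some_iff.1 hn
    exact @of_decide_eq_true _ (inst (x, n)) this.symm
  · rintro ⟨n, hn⟩
    exact ⟨n, Part.mem_some_iff.2 (@decide_eq_true _ (inst (x, n)) hn).symm, fun _ => trivial⟩

lemma tb : PrimrecRel fun u n : ℕ => Nat.testBit u n = true := by
  have hpow : Primrec₂ fun a b : ℕ => a ^ b := Primrec₂.unpaired'.1 Nat.Primrec.pow
  have : PrimrecRel fun u n : ℕ => u / 2 ^ n % 2 = 1 :=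
    Primrec.eq.comp (Primrec.nat_mod.comp (Primrec.nat_div.comp Primrec.fst
      (hpow.comp (Primrec.const 2) Primrec.snd)) (Primrec.const 2)) (Primrec.const 1)
  refine this.of_eq fun u n => ?_
  simp [Nat.testBit_eq_decide_div_mod_eq]

/-- an operator given by some index -/
def IsOp (Φ : Set ℕ → Set ℕ) : Prop := ∃ e, ∀ B, Φ B = eOp e B

lemma IsOp.eOp (i : ℕ) : IsOp (eOp i) := ⟨i, fun _ => rfl⟩

lemma isOp_of_re {R : ℕ → ℕ → Prop} (hR : REPred fun x : ℕ => R x.unpair.1 x.unpair.2)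
    {Φ : Set ℕ → Set ℕ} (h : ∀ B n, n ∈ Φ B ↔ ∃ u, R n u ∧ finCode u ⊆ B) : IsOp Φ := by
  obtain ⟨e, he⟩ := ce_of_re hR
  refine ⟨e, fun B => ?_⟩
  ext n
  rw [h]
  simp [_root_.eOp, he]

lemma fin_code {S : Set ℕ} (hS : S.Finite) : ∃ u, finCode u = S := by
  induction S, hS using Set.Finite.induction_on with
  | empty => exact ⟨0, by ext; simp [finCode]⟩
  | @insert a s _ _ ih =>
    obtain ⟨u, hu⟩ := ih
    refine ⟨u ||| 2 ^ a, ?_⟩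
    rw [← hu]
    ext n
    simp [finCode, Nat.testBit_or, Nat.testBit_two_pow]
    grind

lemma finCode_lt {u n : ℕ} (h : n ∈ finCode u) : n < u := by
  have := Nat.ge_two_pow_of_testBit (show Nat.testBit u n = true from h)
  exact lt_of_lt_of_le Nat.lt_two_pow_self this

lemma finCode_finite (u : ℕ) : (finCode u).Finite :=
  (Set.finite_lt_nat u).subset fun _ h => finCode_lt h

lemma isOp_preimage {φ : ℕ → ℕ} (hφ : Primrec φ) : IsOp (fun B => φ ⁻¹' B) := by
  refine isOp_of_re (R := fun n u => Nat.testBit u (φ n) = true) ?_ ?_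
  · have : PrimrecPred fun x : ℕ => Nat.testBit x.unpair.2 (φ x.unpair.1) = true :=
      tb.comp (Primrec.snd.comp Primrec.unpair) (hφ.comp (Primrec.fst.comp Primrec.unpair))
    exact this.computablePred.to_re
  · intro B n
    constructor
    · intro h
      obtain ⟨u, hu⟩ := fin_code (Set.finite_singleton (φ n))
      refine ⟨u, ?_, ?_⟩
      · change φ n ∈ finCode u; rw [hu]; rfl
      · rw [hu]; simpa using h
    · rintro ⟨u, h1, h2⟩; exact h2 h1

lemma isOp_const {C : ℕ → Prop} (hC : PrimrecPred C) : IsOp (fun _ => {n | C n}) := by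
  refine isOp_of_re (R := fun n _ => C n) ?_ ?_
  · exact (hC.comp (Primrec.fst.comp Primrec.unpair)).computablePred.to_re
  · intro B n
    constructor
    · intro h; exact ⟨0, h, by simp [finCode]⟩
    · rintro ⟨u, h1, h2⟩; exact h1

lemma mem_ce (i x : ℕ) : x ∈ ceSet i ↔
    ∃ k, (Code.evaln k (Denumerable.ofNat Code i) x).isSome = true := by
  simp only [ceSet, Set.mem_ofPred_eq, Part.dom_iff_mem, Code.evaln_complete, Option.isSome_iff_exists]
  constructor
  · rintro ⟨y, k, h⟩; exact ⟨k, y, h⟩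
  · rintro ⟨k, y, h⟩; exact ⟨y, k, h⟩

/-- stage approximation -/
def St (i k x : ℕ) : Prop := (Code.evaln k (Denumerable.ofNat Code i) x).isSome = true

lemma St_mono {i k l x : ℕ} (hkl : k ≤ l) (h : St i k x) : St i l x := by
  unfold St at *
  rw [Option.isSome_iff_exists] at *
  obtain ⟨y, hy⟩ := h
  exact ⟨y, Code.evaln_mono hkl hy⟩

lemma St_prim (i : ℕ) : PrimrecRel (St i) := by
  have h : Primrec fun a : ℕ × ℕ => (Code.evaln a.1 (Denumerable.ofNat Code i) a.2) :=
    Code.primrec_evaln.comp ((Primrec.fst.pair (Primrec.const _)).pair Primrec.snd)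
  exact Primrec.eq.comp (Primrec.option_isSome.comp h) (Primrec.const true)

lemma ex_lt {β : Type} [Primcodable β] {R : ℕ → β → Prop} (hf : PrimrecRel R) :
    PrimrecRel fun (n : ℕ) (y : β) => ∃ x < n, R x y :=
  (hf.exists_mem_list.comp (Primrec.list_range.comp Primrec.fst) Primrec.snd).of_eq (by simp)

lemma all_lt {β : Type} [Primcodable β] {R : ℕ → β → Prop} (hf : PrimrecRel R) :
    PrimrecRel fun (n : ℕ) (y : β) => ∀ x < n, R x y :=
  (hf.forall_mem_list.comp (Primrec.list_range.comp Primrec.fst) Primrec.snd).of_eq (by simp)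

lemma comp_re (i j : ℕ) : REPred fun x : ℕ => ∃ s, ∃ v < s, St i s (Nat.pair x.unpair.1 v) ∧
    ∀ m < s, Nat.testBit v m = true → ∃ w < s, St j s (Nat.pair m w) ∧
      ∀ y < s, Nat.testBit w y = true → Nat.testBit x.unpair.2 y = true := by
  apply re_of_ex
  have h1 : PrimrecRel fun (y : ℕ) (p : ℕ × ℕ) => Nat.testBit p.1 y = true → Nat.testBit p.2 y = true := by
    have : PrimrecRel fun (y : ℕ) (p : ℕ × ℕ) => ¬ Nat.testBit p.1 y = true ∨ Nat.testBit p.2 y = true :=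
      (tb.comp (Primrec.fst.comp Primrec.snd) Primrec.fst).not.or
        (tb.comp (Primrec.snd.comp Primrec.snd) Primrec.fst)
    exact this.of_eq fun a b => by tauto
  have h1' := all_lt h1
  have h2 : PrimrecRel fun (w : ℕ) (p : ℕ × ℕ × ℕ) => St j p.1 (Nat.pair p.2.1 w) ∧
      ∀ y < p.1, Nat.testBit w y = true → Nat.testBit p.2.2 y = true := by
    refine PrimrecPred.and ?_ ?_
    · exact (St_prim j).comp (Primrec.fst.comp Primrec.snd)
        (Primrec₂.natPair.comp (Primrec.fst.comp (Primrec.snd.comp Primrec.snd)) Primrec.fst)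
    · exact h1'.comp (Primrec.fst.comp Primrec.snd)
        (Primrec.fst.pair (Primrec.snd.comp (Primrec.snd.comp Primrec.snd)))
  have h2' := ex_lt h2
  have h3 : PrimrecRel fun (m : ℕ) (p : ℕ × ℕ × ℕ) => Nat.testBit p.2.1 m = true →
      ∃ w < p.1, St j p.1 (Nat.pair m w) ∧
      ∀ y < p.1, Nat.testBit w y = true → Nat.testBit p.2.2 y = true := by
    have : PrimrecRel fun (m : ℕ) (p : ℕ × ℕ × ℕ) => ¬ Nat.testBit p.2.1 m = true ∨
      ∃ w < p.1, St j p.1 (Nat.pair m w) ∧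
      ∀ y < p.1, Nat.testBit w y = true → Nat.testBit p.2.2 y = true := by
      refine PrimrecPred.or (PrimrecPred.not ?_) ?_
      · exact tb.comp (Primrec.fst.comp (Primrec.snd.comp Primrec.snd)) Primrec.fst
      · exact h2'.comp (Primrec.fst.comp Primrec.snd)
          ((Primrec.fst.comp Primrec.snd).pair (Primrec.fst.pair
            (Primrec.snd.comp (Primrec.snd.comp Primrec.snd))))
    exact this.of_eq fun a b => by tauto
  have h3' := all_lt h3
  have h4 : PrimrecRel fun (v : ℕ) (p : ℕ × ℕ) => St i p.1 (Nat.pair p.2.unpair.1 v) ∧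
      ∀ m < p.1, Nat.testBit v m = true → ∃ w < p.1, St j p.1 (Nat.pair m w) ∧
      ∀ y < p.1, Nat.testBit w y = true → Nat.testBit p.2.unpair.2 y = true := by
    refine PrimrecPred.and ?_ ?_
    · exact (St_prim i).comp (Primrec.fst.comp Primrec.snd)
        (Primrec₂.natPair.comp (Primrec.fst.comp (Primrec.unpair.comp
          (Primrec.snd.comp Primrec.snd))) Primrec.fst)
    · exact h3'.comp (Primrec.fst.comp Primrec.snd)
        ((Primrec.fst.comp Primrec.snd).pair (Primrec.fst.pair
          (Primrec.snd.comp (Primrec.unpair.comp (Primrec.snd.comp Primrec.snd)))))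
  have h4' := ex_lt h4
  exact h4'.comp Primrec.snd (Primrec.snd.pair Primrec.fst)

lemma comp_op (i j : ℕ) : IsOp (fun B => eOp i (eOp j B)) := by
  refine isOp_of_re (R := fun n u => ∃ s, ∃ v < s, St i s (Nat.pair n v) ∧
    ∀ m < s, Nat.testBit v m = true → ∃ w < s, St j s (Nat.pair m w) ∧
      ∀ y < s, Nat.testBit w y = true → Nat.testBit u y = true) (comp_re i j) ?_
  intro B n
  constructor
  · rintro ⟨v, hv, hvB⟩
    have hv' := (mem_ce _ _).1 hv
    obtain ⟨k, hk⟩ := hv'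
    have : ∀ m, ∃ w l, m ∈ finCode v → St j l (Nat.pair m w) ∧ finCode w ⊆ B := by
      intro m
      by_cases hm : m ∈ finCode v
      · obtain ⟨w, hw, hwB⟩ := hvB hm
        obtain ⟨l, hl⟩ := (mem_ce _ _).1 hw
        exact ⟨w, l, fun _ => ⟨hl, hwB⟩⟩
      · exact ⟨0, 0, fun h => absurd h hm⟩
    choose w l hwl using this
    obtain ⟨u, hu⟩ := fin_code (S := ⋃ m ∈ finCode v, finCode (w m))
      ((finCode_finite v).biUnion fun m _ => finCode_finite _)
    refine ⟨u, ?_, ?_⟩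
    · set s := k + v + 1 + ∑ m ∈ Finset.range v, (w m + l m) with hs
      have hle : ∀ m < v, w m + l m ≤ ∑ m ∈ Finset.range v, (w m + l m) := fun m hm =>
        Finset.single_le_sum (f := fun m => w m + l m) (fun _ _ => Nat.zero_le _)
          (Finset.mem_range.2 hm)
      refine ⟨s, v, by omega, St_mono (by omega) hk, fun m _ hm => ?_⟩
      have hmv : m < v := finCode_lt hm
      have h1 := hle m hmv
      refine ⟨w m, by omega, St_mono (by omega) (hwl m hm).1, fun y _ hy => ?_⟩
      change y ∈ finCode u
      rw [hu]
      exact Set.mem_biUnion (show m ∈ finCode v from hm) hy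
    · rw [hu]
      exact Set.iUnion₂_subset fun m hm => (hwl m hm).2
  · rintro ⟨u, ⟨s, v, hvs, hv, H⟩, huB⟩
    refine ⟨v, (mem_ce _ _).2 ⟨s, hv⟩, fun m hm => ?_⟩
    have hmv : m < v := finCode_lt hm
    obtain ⟨w, hws, hw, hy⟩ := H m (by omega) hm
    refine ⟨w, (mem_ce _ _).2 ⟨s, hw⟩, fun y hyw => huB ?_⟩
    have := finCode_lt hyw
    exact hy y (by omega) hyw

lemma IsOp.comp {Φ Ψ : Set ℕ → Set ℕ} (h1 : IsOp Φ) (h2 : IsOp Ψ) : IsOp (fun B => Φ (Ψ B)) := by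
  obtain ⟨i, hi⟩ := h1
  obtain ⟨j, hj⟩ := h2
  obtain ⟨k, hk⟩ := comp_op i j
  exact ⟨k, fun B => by rw [← hk]; simp only [hi, hj]⟩

lemma mem_join {A B : Set ℕ} {n : ℕ} : n ∈ eJoin A B ↔
    (n % 2 = 0 ∧ n / 2 ∈ A) ∨ (n % 2 = 1 ∧ n / 2 ∈ B) := by
  simp only [eJoin, Set.mem_ofPred_eq]
  constructor
  · rintro (⟨m, hm, rfl⟩ | ⟨m, hm, rfl⟩)
    · left; exact ⟨by omega, by rwa [show 2 * m / 2 = m by omega]⟩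
    · right; exact ⟨by omega, by rwa [show (2 * m + 1) / 2 = m by omega]⟩
  · rintro (⟨h, hm⟩ | ⟨h, hm⟩)
    · left; exact ⟨_, hm, by omega⟩
    · right; exact ⟨_, hm, by omega⟩

lemma IsOp.join {Φ Ψ : Set ℕ → Set ℕ} (h1 : IsOp Φ) (h2 : IsOp Ψ) :
    IsOp (fun B => eJoin (Φ B) (Ψ B)) := by
  obtain ⟨i, hi⟩ := h1
  obtain ⟨j, hj⟩ := h2
  refine isOp_of_re (R := fun n u => ∃ s, (n % 2 = 0 ∧ St i s (Nat.pair (n / 2) u)) ∨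
    (n % 2 = 1 ∧ St j s (Nat.pair (n / 2) u))) ?_ ?_
  · apply re_of_ex
    have a1 : Primrec fun p : ℕ × ℕ => p.1.unpair.1 % 2 :=
      Primrec.nat_mod.comp (Primrec.fst.comp (Primrec.unpair.comp Primrec.fst)) (Primrec.const 2)
    have a2 : Primrec fun p : ℕ × ℕ => Nat.pair (p.1.unpair.1 / 2) p.1.unpair.2 :=
      Primrec₂.natPair.comp (Primrec.nat_div.comp (Primrec.fst.comp (Primrec.unpair.comp Primrec.fst))
        (Primrec.const 2)) (Primrec.snd.comp (Primrec.unpair.comp Primrec.fst))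
    exact PrimrecPred.or
      (PrimrecPred.and (Primrec.eq.comp a1 (Primrec.const 0)) ((St_prim i).comp Primrec.snd a2))
      (PrimrecPred.and (Primrec.eq.comp a1 (Primrec.const 1)) ((St_prim j).comp Primrec.snd a2))
  · intro B n
    rw [mem_join, hi, hj]
    simp only [_root_.eOp, Set.mem_ofPred_eq, mem_ce]
    constructor
    · rintro (⟨h, u, ⟨k, hk⟩, hu⟩ | ⟨h, u, ⟨k, hk⟩, hu⟩)
      · exact ⟨u, ⟨k, Or.inl ⟨h, hk⟩⟩, hu⟩
      · exact ⟨u, ⟨k, Or.inr ⟨h, hk⟩⟩, hu⟩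
    · rintro ⟨u, ⟨k, ⟨h, hk⟩ | ⟨h, hk⟩⟩, hu⟩
      · exact Or.inl ⟨h, u, ⟨k, hk⟩, hu⟩
      · exact Or.inr ⟨h, u, ⟨k, hk⟩, hu⟩

lemma isOp_id : IsOp (fun B => B) := by
  simpa using isOp_preimage Primrec.id

lemma isOp_left : IsOp (fun B => (fun n => 2 * n) ⁻¹' B) := isOp_preimage Primrec.nat_double
lemma isOp_right : IsOp (fun B => (fun n => 2 * n + 1) ⁻¹' B) :=
  isOp_preimage Primrec.nat_double_succ

lemma left_join (A B : Set ℕ) : (fun n => 2 * n) ⁻¹' (eJoin A B) = A := by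
  ext n; simp [mem_join]
lemma right_join (A B : Set ℕ) : (fun n => 2 * n + 1) ⁻¹' (eJoin A B) = B := by
  ext n; simp only [Set.mem_preimage, mem_join]
  rw [show (2 * n + 1) / 2 = n by omega, show (2 * n + 1) % 2 = 1 by omega]; simp

lemma ELe.of_op {Φ : Set ℕ → Set ℕ} (h : IsOp Φ) (B : Set ℕ) : ELe (Φ B) B := by
  obtain ⟨e, he⟩ := h
  exact ⟨e, he B⟩

lemma ele_refl (A : Set ℕ) : ELe A A := ELe.of_op isOp_id A

lemma ele_trans {A B C : Set ℕ} (h1 : ELe A B) (h2 : ELe B C) : ELe A C := by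
  obtain ⟨i, rfl⟩ := h1
  obtain ⟨j, rfl⟩ := h2
  exact ELe.of_op (comp_op i j) C

lemma ele_left (A B : Set ℕ) : ELe A (eJoin A B) := by
  have := ELe.of_op isOp_left (eJoin A B)
  rwa [left_join] at this

lemma ele_right (A B : Set ℕ) : ELe B (eJoin A B) := by
  have := ELe.of_op isOp_right (eJoin A B)
  rwa [right_join] at this

lemma eOp_mono (i : ℕ) {A B : Set ℕ} (h : A ⊆ B) : eOp i A ⊆ eOp i B := by
  rintro n ⟨u, hu, hA⟩
  exact ⟨u, hu, hA.trans h⟩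

lemma join_mono (Y : Set ℕ) {A B : Set ℕ} (h : A ⊆ B) : eJoin Y A ⊆ eJoin Y B := by
  intro n hn
  rw [mem_join] at *
  exact hn.imp id fun ⟨a, b⟩ => ⟨a, h b⟩

/-! ### measurability -/

lemma meas_eOp (i : ℕ) : Measurable (eOp i) := by
  rw [measurable_set_iff]
  intro n
  simp only [_root_.eOp, Set.mem_ofPred_eq]
  refine Measurable.exists fun u => Measurable.and measurable_const ?_
  exact Measurable.forall fun m => Measurable.imp measurable_const (measurable_set_mem m)

lemma meas_mem {f : Set ℕ → Set ℕ} (hf : Measurable f) (n : ℕ) : Measurable fun X => n ∈ f X :=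
  measurable_set_iff.1 hf n

lemma meas_join {f g : Set ℕ → Set ℕ} (hf : Measurable f) (hg : Measurable g) :
    Measurable fun X => eJoin (f X) (g X) := by
  rw [measurable_set_iff]
  intro n
  simp only [mem_join]
  exact (measurable_const.and (meas_mem hf _)).or (measurable_const.and (meas_mem hg _))

lemma meas_eq {f g : Set ℕ → Set ℕ} (hf : Measurable f) (hg : Measurable g) :
    Measurable fun X => f X = g X := by
  simp only [Set.ext_iff]
  exact Measurable.forall fun n => (meas_mem hf n).iff (meas_mem hg n)

/-! ### the iterated `K` and the skip -/

/-- iterated operators -/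
def it (L : List ℕ) (X : Set ℕ) : Set ℕ := L.foldl (fun S i => eOp i S) X

/-- iterated version of `K` -/
def KK (X : Set ℕ) : Set ℕ :=
  {m | m.unpair.1 ∈ it (Denumerable.ofNat (List ℕ) m.unpair.2) X}

lemma meas_it (L : List ℕ) : Measurable (it L) := by
  induction L with
  | nil => exact measurable_id
  | cons i L ih => exact ih.comp (meas_eOp i)

lemma meas_KKc : Measurable fun X => (KK X)ᶜ := by
  rw [measurable_set_iff]
  intro n
  exact (meas_mem (meas_it _) _).not

lemma KKc_not_le (X : Set ℕ) : ¬ ELe (KK X)ᶜ X := by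
  rintro ⟨i, hi⟩
  have hp : Primrec fun n : ℕ => Nat.pair n (Encodable.encode [n]) :=
    Primrec₂.natPair.comp Primrec.id (Primrec.encode.comp
      (Primrec.list_cons.comp Primrec.id (Primrec.const [])))
  obtain ⟨e, he⟩ := (isOp_preimage hp).comp (IsOp.eOp i)
  have h1 : e ∈ eOp e X ↔ Nat.pair e (Encodable.encode [e]) ∈ eOp i X := by
    rw [← he X]; rfl
  have h2 : Nat.pair e (Encodable.encode [e]) ∈ KK X ↔ e ∈ eOp e X := by
    simp only [KK, Set.mem_ofPred_eq, Nat.unpair_pair, Denumerable.ofNat_encode]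
    rfl
  have hi' : (KK X)ᶜ = eOp i X := hi
  rw [← hi', Set.mem_compl_iff, h2] at h1
  tauto

lemma KKc_unif (i : ℕ) : ∃ φ : ℕ → ℕ, Primrec φ ∧
    ∀ B, (KK (eOp i B))ᶜ = φ ⁻¹' (KK B)ᶜ := by
  have hp : Primrec fun m : ℕ => Nat.pair m.unpair.1 (Nat.pair i m.unpair.2 + 1) :=
    Primrec₂.natPair.comp (Primrec.fst.comp Primrec.unpair)
      (Primrec.succ.comp (Primrec₂.natPair.comp (Primrec.const i) (Primrec.snd.comp Primrec.unpair)))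
  refine ⟨_, hp, fun B => ?_⟩
  ext m
  have key : m ∈ KK (eOp i B) ↔ Nat.pair m.unpair.1 (Nat.pair i m.unpair.2 + 1) ∈ KK B := by
    have : Nat.pair i m.unpair.2 + 1 =
        Encodable.encode (i :: Denumerable.ofNat (List ℕ) m.unpair.2) := by
      simp [Encodable.encode_list_cons]
    simp only [KK, Set.mem_ofPred_eq, Nat.unpair_pair, this, Denumerable.ofNat_encode]
    rfl
  simp only [Set.mem_compl_iff, Set.mem_preimage, key]

/-- the functions of the antichain, from a class `S` -/
noncomputable def ff (S : Set ℕ → Prop) (X : Set ℕ) : Set ℕ :=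
  eJoin (if S X then (KK X)ᶜ else ∅) X

lemma ff_inj (S : Set ℕ → Prop) : Function.Injective (ff S) := by
  intro X Z h
  rw [← right_join (if S X then (KK X)ᶜ else ∅) X, ← right_join (if S Z then (KK Z)ᶜ else ∅) Z]
  exact congrArg _ h

lemma ff_meas {S : Set ℕ → Prop} (hS : Measurable S) : Measurable (ff S) := by
  refine meas_join ?_ measurable_id
  exact Measurable.ite (measurableSet_setOfPred.2 hS) meas_KKc measurable_const

lemma ff_unif_aux (S : Set ℕ → Prop) (i : ℕ) :
    ∃ e, ∀ B, (S (eOp i B) ↔ S B) → ff S (eOp i B) = eOp e (ff S B) := by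
  obtain ⟨φ, hφ, hk⟩ := KKc_unif i
  obtain ⟨e, he⟩ := ((isOp_preimage hφ).comp isOp_left).join ((IsOp.eOp i).comp isOp_right)
  refine ⟨e, fun B hB => ?_⟩
  rw [← he]
  unfold ff
  simp only [left_join, right_join]
  by_cases h : S B
  · rw [if_pos h, if_pos (hB.2 h), hk]
  · rw [if_neg h, if_neg (fun h' => h (hB.1 h'))]; rfl

lemma ff_unif {S : Set ℕ → Prop} (hS : ∀ A B, EEquiv A B → (S A ↔ S B)) :
    UniformlyEInvariant (ff S) := by
  choose e he using ff_unif_aux S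
  refine ⟨fun p => Nat.pair (e p.unpair.1) (e p.unpair.2), ?_⟩
  intro A _ B _ i j hAB
  have hS' := hS A B ⟨⟨i, hAB.1⟩, ⟨j, hAB.2⟩⟩
  simp only [Nat.unpair_pair]
  have h1 : A = eOp i B := hAB.1
  have h2 : B = eOp j A := hAB.2
  constructor
  · change ff S A = eOp (e i) (ff S B)
    rw [← he i B (by rw [← h1]; exact hS'), ← h1]
  · change ff S B = eOp (e j) (ff S A)
    rw [← he j A (by rw [← h2]; exact hS'.symm), ← h2]

lemma empty_join_le (X : Set ℕ) : ELe (eJoin ∅ X) X := by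
  have h : PrimrecPred fun _ : ℕ => False := PrimrecPred.of_eq
    (Primrec.eq.comp (Primrec.const 0) (Primrec.const 1)) (fun n => by simp)
  have := ELe.of_op ((isOp_const h).join isOp_id) X
  simpa using this

lemma ff_not_le {S S' : Set ℕ → Prop} {X : Set ℕ} (h : S X) (h' : ¬ S' X) :
    ¬ ELe (ff S X) (ff S' X) := by
  unfold ff
  rw [if_pos h, if_neg h']
  intro H
  exact KKc_not_le X (ele_trans (ele_left _ _) (ele_trans H (empty_join_le X)))

/-! ### measurable recursion -/

lemma sel_step {R : Set ℕ → ℕ × ℕ → ℕ × ℕ → Prop} (hR : ∀ a b, Measurable fun Y => R Y a b)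
    (hex : ∀ Y a, ∃ b, R Y a b) (st : Set ℕ → ℕ × ℕ) (hst : Measurable st) :
    ∃ st' : Set ℕ → ℕ × ℕ, Measurable st' ∧ ∀ Y, R Y (st Y) (st' Y) := by
  have hR' : ∀ b, Measurable fun Y => R Y (st Y) b := by
    intro b
    have : (fun Y => R Y (st Y) b) = fun Y => ∃ a, st Y = a ∧ R Y a b := by
      funext Y; simp
    rw [this]
    exact Measurable.exists fun a => (hst.eq_const a).and (hR a b)
  have hex' : ∀ Y, ∃ N : ℕ, R Y (st Y) N.unpair := fun Y => by
    obtain ⟨b, hb⟩ := hex Y (st Y)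
    exact ⟨Nat.pair b.1 b.2, by simpa using hb⟩
  refine ⟨fun Y => (Nat.find (hex' Y)).unpair, ?_, fun Y => Nat.find_spec (hex' Y)⟩
  exact (measurable_of_countable Nat.unpair).comp
    (measurable_find hex' fun k => measurableSet_setOfPred.2 (hR' k.unpair))

lemma sel {R : ℕ → Set ℕ → ℕ × ℕ → ℕ × ℕ → Prop} (hR : ∀ s a b, Measurable fun Y => R s Y a b)
    (hex : ∀ s Y a, ∃ b, R s Y a b) :
    ∃ st : ℕ → Set ℕ → ℕ × ℕ, (∀ s, Measurable (st s)) ∧ ∀ s Y, R s Y (st s Y) (st (s + 1) Y) := by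
  choose g hg1 hg2 using fun s => sel_step (hR s) (hex s)
  let st : ℕ → {f : Set ℕ → ℕ × ℕ // Measurable f} := fun s =>
    Nat.rec ⟨fun _ => (0, 0), measurable_const⟩ (fun s f => ⟨g s f.1 f.2, hg1 s f.1 f.2⟩) s
  exact ⟨fun s => (st s).1, fun s => (st s).2, fun s Y => hg2 s (st s).1 (st s).2 Y⟩

/-! ### the generic construction -/

/-- upper bound of a condition -/
def UU (a : ℕ × ℕ) : Set ℕ := {n | n ∈ finCode a.1 ∨ a.2 ≤ n}

/-- inconsistent -/
def Inc (Z : Set ℕ) : Prop := ∃ n, 2 * n ∈ Z ∧ 2 * n + 1 ∈ Z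

/-- total sets -/
def Tot (Z : Set ℕ) : Prop := ∀ n, 2 * n ∈ Z ↔ 2 * n + 1 ∉ Z

lemma meas_Inc : Measurable Inc :=
  Measurable.exists fun n => (measurable_set_mem _).and (measurable_set_mem _)

lemma meas_Tot : Measurable Tot :=
  Measurable.forall fun n => (measurable_set_mem _).iff (measurable_set_mem _).not

lemma tot_eq {Z W : Set ℕ} (hZ : Tot Z) (hZW : Z ⊆ W) (hW : ¬ Inc W) : Z = W := by
  refine hZW.antisymm fun n hn => ?_
  by_contra hnZ
  apply hW
  obtain ⟨m, rfl | rfl⟩ : ∃ m, n = 2 * m ∨ n = 2 * m + 1 := ⟨n / 2, by omega⟩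
  · have : 2 * m + 1 ∈ Z := by
      by_contra h; exact hnZ ((hZ m).2 h)
    exact ⟨m, hn, hZW this⟩
  · exact ⟨m, hZW ((hZ m).2 hnZ), hn⟩

/-- the step relation -/
def RR (h : ℕ → Set ℕ → Set ℕ) (s : ℕ) (Y : Set ℕ) (a b : ℕ × ℕ) : Prop :=
  finCode a.1 ⊆ finCode b.1 ∧ UU b ⊆ UU a ∧
  (Inc (eOp s (eJoin Y (finCode b.1))) ∨ ¬ Inc (eOp s (eJoin Y (UU a)))) ∧
  ∃ n, (n ∈ finCode b.1 ∧ n ∉ eOp s.unpair.1 (h s.unpair.2 Y)) ∨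
    (n ∉ UU b ∧ n ∈ eOp s.unpair.1 (h s.unpair.2 Y))

lemma RR_meas {h : ℕ → Set ℕ → Set ℕ} (hh : ∀ k, Measurable (h k)) (s : ℕ) (a b : ℕ × ℕ) :
    Measurable fun Y => RR h s Y a b := by
  have hm : ∀ n, Measurable fun Y => n ∈ eOp s.unpair.1 (h s.unpair.2 Y) := fun n =>
    meas_mem ((meas_eOp _).comp (hh _)) n
  have hi : ∀ V : Set ℕ, Measurable fun Y => Inc (eOp s (eJoin Y V)) := fun V =>
    meas_Inc.comp ((meas_eOp s).comp (meas_join measurable_id measurable_const))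
  refine measurable_const.and (measurable_const.and (((hi _).or (hi _).not).and ?_))
  exact Measurable.exists fun n =>
    (measurable_const.and (hm n).not).or (measurable_const.and (hm n))

lemma join_use {Y V : Set ℕ} {u : ℕ} (hu : finCode u ⊆ eJoin Y V) :
    ∃ W, W.Finite ∧ W ⊆ V ∧ finCode u ⊆ eJoin Y W := by
  refine ⟨V ∩ {n | n ≤ u}, (Set.finite_le_nat u).inter_of_right _, Set.inter_subset_left, ?_⟩
  intro n hn
  have h1 := hu hn
  have h2 := finCode_lt hn
  rw [mem_join] at *
  refine h1.imp id fun ⟨a, b⟩ => ⟨a, b, ?_⟩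
  change n / 2 ≤ u
  omega

lemma RR_ex (h : ℕ → Set ℕ → Set ℕ) (s : ℕ) (Y : Set ℕ) (a : ℕ × ℕ) : ∃ b, RR h s Y a b := by
  -- first part
  obtain ⟨F, hF1, hF2, hF3⟩ : ∃ F : ℕ, finCode a.1 ⊆ finCode F ∧ finCode F ⊆ UU a ∧
      (Inc (eOp s (eJoin Y (finCode F))) ∨ ¬ Inc (eOp s (eJoin Y (UU a)))) := by
    by_cases hI : Inc (eOp s (eJoin Y (UU a)))
    · obtain ⟨n, ⟨u, hu, hu'⟩, ⟨v, hv, hv'⟩⟩ := hI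
      obtain ⟨W, hW1, hW2, hW3⟩ := join_use hu'
      obtain ⟨W', hW1', hW2', hW3'⟩ := join_use hv'
      obtain ⟨F, hF⟩ := fin_code ((finCode_finite a.1).union (hW1.union hW1'))
      refine ⟨F, ?_, ?_, Or.inl ⟨n, ⟨u, hu, hW3.trans (join_mono Y ?_)⟩,
        ⟨v, hv, hW3'.trans (join_mono Y ?_)⟩⟩⟩ <;> rw [hF]
      · exact Set.subset_union_left
      · exact Set.union_subset (fun n hn => Or.inl hn) (Set.union_subset hW2 hW2')
      · exact Set.subset_union_left.trans Set.subset_union_right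
      · exact Set.subset_union_right.trans Set.subset_union_right
    · exact ⟨a.1, subset_rfl, fun n hn => Or.inl hn, Or.inr hI⟩
  -- second part
  set n := a.2 + F with hn
  have hnF : n ∉ finCode F := fun h' => by have := finCode_lt h'; omega
  by_cases hD : n ∈ eOp s.unpair.1 (h s.unpair.2 Y)
  · refine ⟨(F, n + 1), hF1, ?_, hF3, n, Or.inr ⟨?_, hD⟩⟩
    · rintro x (hx | hx)
      · exact hF2 hx
      · right; simp only at hx; omega
    · rintro (hx | hx)
      · exact hnF hx
      · simp only at hx; omega
  · obtain ⟨F', hF'⟩ := fin_code ((finCode_finite F).insert n)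
    have hsub : finCode F ⊆ finCode F' := by rw [hF']; exact Set.subset_insert _ _
    refine ⟨(F', n + 1), hF1.trans hsub, ?_, ?_, n, Or.inl ⟨?_, hD⟩⟩
    · rintro x (hx | hx)
      · simp only [hF'] at hx
        rcases hx with rfl | hx
        · right; omega
        · exact hF2 hx
      · right; simp only at hx; omega
    · refine hF3.imp ?_ id
      rintro ⟨m, h1, h2⟩
      exact ⟨m, eOp_mono s (join_mono Y hsub) h1, eOp_mono s (join_mono Y hsub) h2⟩
    · simp only [hF']; exact Set.mem_insert _ _

/-- property of the generic functions -/
def Good (H : Set ℕ → Set ℕ) : Prop :=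
  Measurable H ∧ (∀ Y, ELe Y (H Y)) ∧ ∀ Y Z, Tot Z → ELe Z (H Y) → ELe Z Y

lemma UU_op (a : ℕ × ℕ) : IsOp (fun Y => eJoin Y (UU a)) := by
  refine isOp_id.join (isOp_const ?_)
  exact PrimrecPred.or (tb.comp (Primrec.const _) Primrec.id)
    (Primrec.nat_le.comp (Primrec.const _) Primrec.id)

lemma exists_good (h : ℕ → Set ℕ → Set ℕ) (hh : ∀ k, Measurable (h k)) :
    ∃ H, Good H ∧ ∀ Y k, ¬ ELe (H Y) (h k Y) := by
  obtain ⟨st, hst, hR⟩ := sel (RR_meas hh) (RR_ex h)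
  let G : Set ℕ → Set ℕ := fun Y => {n | ∃ s, n ∈ finCode (st s Y).1}
  have hGm : Measurable G := by
    rw [measurable_set_iff]
    intro n
    refine Measurable.exists fun s => ?_
    exact (measurable_of_countable fun p : ℕ × ℕ => n ∈ finCode p.1).comp (hst s)
  have hFm : ∀ Y s t, s ≤ t → finCode (st s Y).1 ⊆ finCode (st t Y).1 := fun Y s t hst =>
    monotone_nat_of_le_succ (f := fun s => finCode (st s Y).1) (fun s => (hR s Y).1) hst
  have hUm : ∀ Y s t, s ≤ t → UU (st t Y) ⊆ UU (st s Y) := fun Y s t hst =>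
    antitone_nat_of_succ_le (f := fun s => UU (st s Y)) (fun s => (hR s Y).2.1) hst
  have hFG : ∀ Y s, finCode (st s Y).1 ⊆ G Y := fun Y s n hn => ⟨s, hn⟩
  have hGU : ∀ Y s, G Y ⊆ UU (st s Y) := by
    rintro Y s n ⟨t, ht⟩
    exact hUm Y s (max s t) (le_max_left _ _) (Or.inl (hFm Y t (max s t) (le_max_right _ _) ht))
  refine ⟨fun Y => eJoin Y (G Y), ⟨meas_join measurable_id hGm, fun Y => ele_left _ _, ?_⟩, ?_⟩
  · rintro Y Z hZ ⟨i, rfl⟩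
    rcases (hR i Y).2.2.1 with hI | hI
    · exfalso
      obtain ⟨m, h1, h2⟩ := hI
      have hs := eOp_mono i (join_mono Y (hFG Y (i + 1)))
      exact (hZ m).1 (hs h1) (hs h2)
    · have := tot_eq hZ (eOp_mono i (join_mono Y (hGU Y i))) hI
      simp only at this ⊢
      rw [this]
      exact ELe.of_op ((IsOp.eOp i).comp (UU_op _)) Y
  · intro Y k hle
    obtain ⟨i, hi⟩ := ele_trans (ele_right Y (G Y)) hle
    have hi' : G Y = eOp i (h k Y) := hi
    obtain ⟨n, hn⟩ := (hR (Nat.pair i k) Y).2.2.2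
    simp only [Nat.unpair_pair, ← hi'] at hn
    rcases hn with ⟨h1, h2⟩ | ⟨h1, h2⟩
    · exact h2 (hFG _ _ h1)
    · exact h1 (hGU _ _ h2)

lemma exists_seq : ∃ H : ℕ → Set ℕ → Set ℕ, (∀ n, Good (H n)) ∧
    ∀ m n, m < n → ∀ Y j, ¬ ELe (H n Y) (H m (eOp j Y)) := by
  refine exists_seq_of_forall_finset_exists Good
    (fun H H' => ∀ Y j, ¬ ELe (H' Y) (H (eOp j Y))) ?_
  intro s hs
  let C : Set (Set ℕ → Set ℕ) := insert id (⋃ x ∈ s, Set.range fun j => fun Y => x (eOp j Y))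
  have hC : C.Countable :=
    (Set.Countable.biUnion s.countable_toSet fun x _ => Set.countable_range _).insert _
  obtain ⟨h, hh⟩ := hC.exists_eq_range ⟨id, Set.mem_insert _ _⟩
  have hm : ∀ k, Measurable (h k) := by
    intro k
    have : h k ∈ C := by rw [hh]; exact Set.mem_range_self k
    rcases this with h1 | h1
    · rw [h1]; exact measurable_id
    · simp only [Set.mem_iUnion, Set.mem_range] at h1
      obtain ⟨x, hx, j, hj⟩ := h1
      rw [← hj]
      exact (hs x hx).1.comp (meas_eOp j)
  obtain ⟨H, hH, hH'⟩ := exists_good h hm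
  refine ⟨H, hH, fun x hx Y j => ?_⟩
  have : (fun Y => x (eOp j Y)) ∈ C := by
    right
    simp only [Set.mem_iUnion, Set.mem_range]
    exact ⟨x, hx, j, rfl⟩
  rw [hh] at this
  obtain ⟨k, hk⟩ := this
  have := hH' Y k
  rwa [hk] at this

/-- the class given by `H` -/
def Cl (H : Set ℕ → Set ℕ) (X : Set ℕ) : Prop :=
  ∃ i j k, Tot (eOp i X) ∧ X = eOp j (H (eOp i X)) ∧ H (eOp i X) = eOp k X

lemma Cl_iff (H : Set ℕ → Set ℕ) (X : Set ℕ) :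
    Cl H X ↔ ∃ Y, Tot Y ∧ ELe Y X ∧ ELe X (H Y) ∧ ELe (H Y) X := by
  constructor
  · rintro ⟨i, j, k, h1, h2, h3⟩
    exact ⟨_, h1, ⟨i, rfl⟩, ⟨j, h2⟩, ⟨k, h3⟩⟩
  · rintro ⟨Y, h1, ⟨i, rfl⟩, ⟨j, h2⟩, ⟨k, h3⟩⟩
    exact ⟨i, j, k, h1, h2, h3⟩

lemma Cl_meas {H : Set ℕ → Set ℕ} (hH : Measurable H) : Measurable (Cl H) := by
  refine Measurable.exists fun i => Measurable.exists fun j => Measurable.exists fun k => ?_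
  have h1 := hH.comp (meas_eOp i)
  exact (meas_Tot.comp (meas_eOp i)).and
    ((meas_eq measurable_id ((meas_eOp j).comp h1)).and (meas_eq h1 (meas_eOp k)))

lemma Cl_inv (H : Set ℕ → Set ℕ) (A B : Set ℕ) (h : EEquiv A B) : Cl H A ↔ Cl H B := by
  have key : ∀ A B, EEquiv A B → Cl H A → Cl H B := by
    intro A B h
    rw [Cl_iff, Cl_iff]
    rintro ⟨Y, h1, h2, h3, h4⟩
    exact ⟨Y, h1, ele_trans h2 h.1, ele_trans h.2 h3, ele_trans h4 h.1⟩
  exact ⟨key A B h, key B A ⟨h.2, h.1⟩⟩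

lemma Cl_cofinal {H : Set ℕ → Set ℕ} (hH : Good H) (D : Set ℕ) : ∃ X, ELe D X ∧ Cl H X := by
  refine ⟨H (eJoin D Dᶜ), ele_trans (ele_left _ _) (hH.2.1 _), (Cl_iff _ _).2
    ⟨eJoin D Dᶜ, ?_, hH.2.1 _, ele_refl _, ele_refl _⟩⟩
  intro n
  have h1 : 2 * n ∈ eJoin D Dᶜ ↔ n ∈ D := by
    change n ∈ (fun n => 2 * n) ⁻¹' eJoin D Dᶜ ↔ _
    rw [left_join]
  have h2 : 2 * n + 1 ∈ eJoin D Dᶜ ↔ n ∈ Dᶜ := by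
    change n ∈ (fun n => 2 * n + 1) ⁻¹' eJoin D Dᶜ ↔ _
    rw [right_join]
  rw [h1, h2]
  simp

lemma Cl_disj {H H' : Set ℕ → Set ℕ} (hH : Good H) (hH' : Good H')
    (h : ∀ Y j, ¬ ELe (H' Y) (H (eOp j Y))) {X : Set ℕ} (h1 : Cl H X) (h2 : Cl H' X) : False := by
  rw [Cl_iff] at h1 h2
  obtain ⟨Z, z1, z2, z3, z4⟩ := h1
  obtain ⟨Y, y1, y2, y3, y4⟩ := h2
  obtain ⟨j, rfl⟩ := hH'.2.2 Y Z z1 (ele_trans z2 y3)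
  exact h Y j (ele_trans y4 z3)

end AC

/-- There is an infinite antichain under `≤ₑ^▽` consisting of Borel, injective,
uniformly e-invariant functions. -/
theorem exists_infinite_antichain :
    ∃ f : ℕ → (Set ℕ → Set ℕ),
      (∀ n : ℕ, BorelFun (f n) ∧ Function.Injective (f n) ∧ UniformlyEInvariant (f n)) ∧
      (∀ m n : ℕ, m ≠ n → ¬ ConeLe (f m) (f n)) := by
  obtain ⟨H, hH, hlt⟩ := AC.exists_seq
  refine ⟨fun n => AC.ff (AC.Cl (H n)), fun n => ⟨AC.ff_meas (AC.Cl_meas (hH n).1), AC.ff_inj _,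
    AC.ff_unif (AC.Cl_inv (H n))⟩, ?_⟩
  rintro m n hmn ⟨D, hD⟩
  obtain ⟨X, hX1, hX2⟩ := AC.Cl_cofinal (hH m) D
  refine AC.ff_not_le hX2 (fun hX3 => ?_) (hD X hX1)
  rcases lt_or_gt_of_ne hmn with h | h
  · exact AC.Cl_disj (hH m) (hH n) (hlt m n h) hX2 hX3
  · exact AC.Cl_disj (hH n) (hH m) (hlt n m h) hX3 hX2
end

section
/- Let A ⊆ ℕ and let f be a uniformly e-invariant function defined on deg_e(A) (the ≡_e-class of A) with values in P(ℕ). If f is not constant, then there is B ∈ deg_e(A) such that f(A ⊕ B) ≠ f(A ⊕ ∅) or f(A ⊕ B) ≠ f(∅ ⊕ B). -/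
open Classical

theorem ceSet_guard (e : ℕ) (b : ℕ → Bool) (g : ℕ → ℕ) (hb : Computable b) (hg : Computable g) :
    ∃ e', ∀ p, p ∈ ceSet e' ↔ b p = true ∧ g p ∈ ceSet e := by
  have h1 : Partrec fun p => (Denumerable.ofNat Nat.Partrec.Code e).eval (g p) :=
    (Partrec.nat_iff.2 (Nat.Partrec.Code.exists_code.2 ⟨_, rfl⟩)).comp hg
  have h2 : Partrec fun p => bif b p then
      (Denumerable.ofNat Nat.Partrec.Code e).eval (g p) else Part.none :=
    Partrec.cond hb h1 Partrec.none
  obtain ⟨c, hc⟩ := Nat.Partrec.Code.exists_code.1 (Partrec.nat_iff.1 h2)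
  refine ⟨Encodable.encode c, fun p => ?_⟩
  simp only [ceSet, Set.mem_ofPred_eq, Denumerable.ofNat_encode, hc]
  cases b p <;> simp

theorem ceSet_total : ∃ e, ∀ p, p ∈ ceSet e := by
  refine ⟨Encodable.encode Nat.Partrec.Code.zero, fun p => ?_⟩
  simp only [ceSet, Set.mem_ofPred_eq, Denumerable.ofNat_encode, Nat.Partrec.Code.eval]
  trivial

theorem primrec_bit : Primrec₂ fun v j : ℕ => v / 2 ^ j % 2 := by
  have hp : Primrec₂ ((· ^ ·) : ℕ → ℕ → ℕ) := Primrec₂.unpaired'.1 Nat.Primrec.pow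
  exact Primrec.nat_mod.comp (Primrec.nat_div.comp Primrec.fst
    (hp.comp (Primrec.const 2) Primrec.snd)) (Primrec.const 2)

theorem primrec_testBit : Primrec₂ fun v j : ℕ => Nat.testBit v j := by
  have h : Primrec fun p : ℕ × ℕ => (p.1 / 2 ^ p.2 % 2).bodd :=
    Primrec.nat_bodd.comp primrec_bit
  refine h.of_eq fun p => ?_
  change _ = p.1.testBit p.2
  rw [Nat.testBit_eq_decide_div_mod_eq]
  rcases Nat.mod_two_eq_zero_or_one (p.1 / 2 ^ p.2) with h | h <;> simp [h]

/-- The number below `2 ^ k` whose binary digits are given by `b`. -/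
def pick (b : ℕ → Bool) (k : ℕ) : ℕ :=
  Nat.rec (motive := fun _ => ℕ) 0 (fun j s => 2 ^ j * (b j).toNat + s) k

theorem pick_lt (b : ℕ → Bool) (k : ℕ) : pick b k < 2 ^ k := by
  induction k with
  | zero => simp [pick]
  | succ k ih =>
    change 2 ^ k * (b k).toNat + pick b k < 2 ^ (k + 1)
    rw [pow_succ]
    cases b k <;> simp <;> omega

theorem testBit_pick (b : ℕ → Bool) (k m : ℕ) :
    (pick b k).testBit m = true ↔ m < k ∧ b m = true := by
  induction k with
  | zero => simp [pick]
  | succ k ih =>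
    change (2 ^ k * (b k).toNat + pick b k).testBit m = true ↔ _
    rw [Nat.testBit_two_pow_mul_add _ (pick_lt b k)]
    split_ifs with h
    · rw [ih]; constructor
      · rintro ⟨h1, h2⟩; exact ⟨by omega, h2⟩
      · rintro ⟨h1, h2⟩; exact ⟨h, h2⟩
    · rcases Nat.lt_or_ge k m with h' | h'
      · have : m - k ≠ 0 := by omega
        constructor
        · intro hh
          have := Nat.ge_two_pow_of_testBit hh
          have h3 : (2:ℕ) ^ 1 ≤ 2 ^ (m - k) := Nat.pow_le_pow_right (by norm_num) (by omega)
          have h4 : (b k).toNat ≤ 1 := Bool.toNat_le _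
          omega
        · rintro ⟨h1, h2⟩; omega
      · have : m = k := by omega
        subst this
        cases b m <;> simp

theorem lt_of_testBit {u j : ℕ} (h : u.testBit j = true) : j < u :=
  lt_of_lt_of_le Nat.lt_two_pow_self (Nat.ge_two_pow_of_testBit h)

/-- Code of `{m | 2m+1 ∈ D_v}`. -/
def compress (v : ℕ) : ℕ := pick (fun j => v.testBit (2 * j + 1)) v

theorem testBit_compress (v m : ℕ) :
    (compress v).testBit m = true ↔ v.testBit (2 * m + 1) = true := by
  rw [compress, testBit_pick]
  constructor
  · exact fun h => h.2
  · intro h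
    have := lt_of_testBit h
    exact ⟨by omega, h⟩

/-- Code of `{2m+1 | m ∈ D_u}`. -/
def spread (u : ℕ) : ℕ := pick (fun j => j.bodd && u.testBit j.div2) (2 * u + 2)

theorem testBit_spread (u m : ℕ) :
    (spread u).testBit m = true ↔ ∃ j, m = 2 * j + 1 ∧ u.testBit j = true := by
  rw [spread, testBit_pick]
  constructor
  · rintro ⟨h1, h2⟩
    rw [Bool.and_eq_true] at h2
    refine ⟨m.div2, ?_, h2.2⟩
    have := Nat.bodd_add_div2 m
    rw [h2.1] at this
    simp at this
    omega
  · rintro ⟨j, rfl, h⟩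
    have := lt_of_testBit h
    refine ⟨by omega, ?_⟩
    have h5 : (2 * j + 1).div2 = j := by rw [Nat.div2_val]; omega
    simp [h5, h]

theorem compress_spread (u : ℕ) : compress (spread u) = u := by
  apply Nat.eq_of_testBit_eq
  intro i
  rw [Bool.eq_iff_iff, testBit_compress, testBit_spread]
  constructor
  · rintro ⟨j, hj, h⟩
    have : i = j := by omega
    rwa [this]
  · intro h; exact ⟨i, rfl, h⟩

theorem primrec_compress : Primrec compress := by
  have hp : Primrec₂ ((· ^ ·) : ℕ → ℕ → ℕ) := Primrec₂.unpaired'.1 Nat.Primrec.pow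
  have hn : Primrec Bool.toNat := Primrec.dom_finite _
  have hj : Primrec fun q : ℕ × (ℕ × ℕ) => q.2.1 := Primrec.fst.comp Primrec.snd
  have hs : Primrec fun q : ℕ × (ℕ × ℕ) => q.2.2 := Primrec.snd.comp Primrec.snd
  have ht : Primrec fun q : ℕ × (ℕ × ℕ) => q.1.testBit (2 * q.2.1 + 1) :=
    primrec_testBit.comp Primrec.fst
      (Primrec.succ.comp (Primrec.nat_mul.comp (Primrec.const 2) hj))
  have hh : Primrec₂ fun (v : ℕ) (q : ℕ × ℕ) =>
      2 ^ q.1 * (v.testBit (2 * q.1 + 1)).toNat + q.2 :=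
    Primrec.nat_add.comp (Primrec.nat_mul.comp (hp.comp (Primrec.const 2) hj) (hn.comp ht)) hs
  exact Primrec.nat_rec' Primrec.id (Primrec.const 0) hh

theorem exists_id_index : ∃ i, ∀ X : Set ℕ, ELeVia X X i := by
  obtain ⟨t, ht⟩ := ceSet_total
  have hb : Computable fun p : ℕ => p.unpair.2.testBit p.unpair.1 :=
    (primrec_testBit.comp (Primrec.snd.comp Primrec.unpair)
      (Primrec.fst.comp Primrec.unpair)).to_comp
  obtain ⟨e, he⟩ := ceSet_guard t _ id hb Computable.id
  refine ⟨e, fun X => ?_⟩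
  ext n
  simp only [eOp, Set.mem_ofPred_eq, he, ht, and_true, Nat.unpair_pair, finCode]
  constructor
  · intro h
    refine ⟨2 ^ n, by simp, fun m hm => ?_⟩
    have : m = n := by simpa [Nat.testBit_two_pow] using hm
    rwa [this]
  · rintro ⟨u, h1, h2⟩
    exact h2 h1

theorem le_pad (i : ℕ) : ∃ k, ∀ X B : Set ℕ, ELeVia X B i → ELeVia X (eJoin ∅ B) k := by
  have hg : Computable fun p : ℕ => Nat.pair p.unpair.1 (compress p.unpair.2) :=
    (Primrec₂.natPair.comp (Primrec.fst.comp Primrec.unpair)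
      (primrec_compress.comp (Primrec.snd.comp Primrec.unpair))).to_comp
  obtain ⟨e, he⟩ := ceSet_guard i (fun _ => true) _ (Computable.const true) hg
  refine ⟨e, fun X B h => ?_⟩
  unfold ELeVia at *
  subst h
  ext n
  simp only [eOp, Set.mem_ofPred_eq, he, true_and, Nat.unpair_pair]
  constructor
  · rintro ⟨u, h1, h2⟩
    refine ⟨spread u, by rwa [compress_spread], fun m hm => ?_⟩
    obtain ⟨j, rfl, hj⟩ := (testBit_spread u m).1 hm
    exact Or.inr ⟨j, h2 hj, rfl⟩
  · rintro ⟨v, h1, h2⟩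
    refine ⟨_, h1, fun m hm => ?_⟩
    rcases h2 ((testBit_compress v m).1 hm) with ⟨j, hj, _⟩ | ⟨j, hj, h⟩
    · exact hj.elim
    · have : m = j := by omega
      rwa [this]

theorem pad_le (i : ℕ) : ∃ k, ∀ X B : Set ℕ, ELeVia B X i → ELeVia (eJoin ∅ B) X k := by
  have hb : Computable fun p : ℕ => p.unpair.1.bodd :=
    (Primrec.nat_bodd.comp (Primrec.fst.comp Primrec.unpair)).to_comp
  have hg : Computable fun p : ℕ => Nat.pair p.unpair.1.div2 p.unpair.2 :=
    (Primrec₂.natPair.comp (Primrec.nat_div2.comp (Primrec.fst.comp Primrec.unpair))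
      (Primrec.snd.comp Primrec.unpair)).to_comp
  obtain ⟨e, he⟩ := ceSet_guard i _ _ hb hg
  refine ⟨e, fun X B h => ?_⟩
  unfold ELeVia at *
  subst h
  ext n
  simp only [eOp, eJoin, Set.mem_ofPred_eq, he, Nat.unpair_pair]
  constructor
  · rintro (⟨j, hj, _⟩ | ⟨j, ⟨u, h1, h2⟩, rfl⟩)
    · exact hj.elim
    · have h5 : (2 * j + 1).div2 = j := by rw [Nat.div2_val]; omega
      exact ⟨u, ⟨by simp, by rwa [h5]⟩, h2⟩
  · rintro ⟨u, ⟨h0, h1⟩, h2⟩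
    refine Or.inr ⟨n.div2, ⟨u, h1, h2⟩, ?_⟩
    have := Nat.bodd_add_div2 n
    rw [h0] at this
    simp at this
    omega

/-- If `f` is uniformly e-invariant on `deg_e(A)` and not constant, then there
is `B ∈ deg_e(A)` with `f(A ⊕ B) ≠ f(A ⊕ ∅)` or `f(A ⊕ B) ≠ f(∅ ⊕ B)`. -/
theorem exists_padding_witness (A : Set ℕ) (f : Set ℕ → Set ℕ)
    (hf : UniformlyEInvariantOn (edeg A) f)
    (hnc : ¬ ∀ X ∈ edeg A, ∀ Y ∈ edeg A, f X = f Y) :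
    ∃ B ∈ edeg A, f (eJoin A B) ≠ f (eJoin A ∅) ∨ f (eJoin A B) ≠ f (eJoin ∅ B) := by
  by_contra hcon
  push Not at hcon
  obtain ⟨u, hu⟩ := hf
  obtain ⟨i0, hi0⟩ := exists_id_index
  obtain ⟨k, hk⟩ := le_pad i0
  obtain ⟨l, hl⟩ := pad_le i0
  have key : ∀ X ∈ edeg A, f X = eOp (u (Nat.pair k l)).unpair.1 (f (eJoin A ∅)) := by
    intro X hX
    have hX' : eJoin ∅ X ∈ edeg A := by
      obtain ⟨⟨a, ha⟩, ⟨b, hb⟩⟩ := hX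
      obtain ⟨a', ha'⟩ := le_pad a
      obtain ⟨b', hb'⟩ := pad_le b
      exact ⟨⟨a', ha' _ _ ha⟩, ⟨b', hb' _ _ hb⟩⟩
    have h := (hu X hX _ hX' k l ⟨hk _ _ (hi0 X), hl _ _ (hi0 X)⟩).1
    obtain ⟨h1, h2⟩ := hcon X hX
    rw [← h1, h2]
    exact h
  exact hnc fun X hX Y hY => (key X hX).trans (key Y hY).symm
end

section
/- If f : P(ℕ) → P(ℕ) is uniformly e-invariant and f(A) <_e A for some A ⊆ ℕ, then the restriction of f to deg_e(A) is constant. Consequently, every regressive uniformly e-invariant function (one with f(A) <_e A for all A in its domain) is locally constant, i.e., constant on every enumeration degree. -/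
open Classical

namespace EUnif

/-- Relations uniformly enumeration-definable from a set parameter, in a monotone normal form. -/
def EDef {α : Type} [Primcodable α] (S : Set ℕ → α → Prop) : Prop :=
  ∃ R : α × ℕ × ℕ → Prop, PrimrecPred R ∧
    (∀ a s s' v v', s ≤ s' → finCode v ⊆ finCode v' → R (a, s, v) → R (a, s', v')) ∧
    ∀ B a, S B a ↔ ∃ s v, R (a, s, v) ∧ finCode v ⊆ B

theorem primrec_testBit : PrimrecPred fun p : ℕ × ℕ => p.1.testBit p.2 = true := by
  have hpow : Primrec₂ fun a b : ℕ => a ^ b := Primrec₂.unpaired'.1 Nat.Primrec.pow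
  have h : PrimrecPred fun p : ℕ × ℕ => p.1 / 2 ^ p.2 % 2 = 1 :=
    Primrec.eq.comp (Primrec.nat_mod.comp (Primrec.nat_div.comp Primrec.fst
      (hpow.comp (Primrec.const 2) Primrec.snd)) (Primrec.const 2)) (Primrec.const 1)
  refine h.of_eq fun p => ?_
  rw [Nat.testBit_eq_decide_div_mod_eq]; simp

theorem finCode_or (u v : ℕ) : finCode (u ||| v) = finCode u ∪ finCode v := by
  ext n; simp [finCode]

theorem finCode_zero : finCode 0 = ∅ := by
  ext n; simp [finCode]

theorem lt_of_mem_finCode {u x : ℕ} (h : x ∈ finCode u) : x < u := by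
  by_contra hx
  have h1 : u.testBit x = true := h
  have h2 : u < 2 ^ x := lt_of_lt_of_le (Nat.lt_two_pow_self) (Nat.pow_le_pow_right (by norm_num) (not_lt.1 hx))
  rw [Nat.testBit_lt_two_pow h2] at h1
  exact absurd h1 (by simp)

theorem finCode_single (x : ℕ) : finCode (2 ^ x) = {x} := by
  ext n; simp [finCode, Nat.testBit_two_pow, eq_comm]

section closure
variable {α β : Type} [Primcodable α] [Primcodable β]

theorem rel_exists_lt {R : ℕ → β → Prop} (hR : PrimrecRel R) :
    PrimrecRel fun n y => ∃ x < n, R x y :=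
  (hR.exists_mem_list.comp (Primrec.list_range.comp Primrec.fst) Primrec.snd).of_eq (by simp)

theorem rel_forall_lt {R : ℕ → β → Prop} (hR : PrimrecRel R) :
    PrimrecRel fun n y => ∀ x < n, R x y :=
  (hR.forall_mem_list.comp (Primrec.list_range.comp Primrec.fst) Primrec.snd).of_eq (by simp)

theorem EDef.of_iff {S T : Set ℕ → α → Prop} (h : EDef S) (e : ∀ B a, T B a ↔ S B a) : EDef T := by
  obtain ⟨R, h1, h2, h3⟩ := h
  exact ⟨R, h1, h2, fun B a => (e B a).trans (h3 B a)⟩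

theorem EDef.mem {g : α → ℕ} (hg : Primrec g) : EDef fun B a => g a ∈ B := by
  refine ⟨fun p => p.2.2.testBit (g p.1) = true,
    primrec_testBit.comp ((Primrec.snd.comp Primrec.snd).pair (hg.comp Primrec.fst)), ?_, ?_⟩
  · intro a s s' v v' _ hv h
    exact hv h
  · intro B a
    constructor
    · intro h
      refine ⟨0, 2 ^ g a, ?_, ?_⟩
      · simp
      · rw [finCode_single]; simpa using h
    · rintro ⟨s, v, h, hv⟩
      exact hv h

theorem EDef.pure {p : α → Prop} (hp : PrimrecPred p) : EDef fun _ a => p a := by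
  refine ⟨fun q => p q.1, hp.comp Primrec.fst, ?_, ?_⟩
  · intro a s s' v v' _ _ h
    exact h
  · intro B a
    constructor
    · intro h
      exact ⟨0, 0, h, by simp [finCode_zero]⟩
    · rintro ⟨s, v, h, hv⟩
      exact h

theorem EDef.subst {S : Set ℕ → β → Prop} (h : EDef S) {g : α → β} (hg : Primrec g) :
    EDef fun B a => S B (g a) := by
  obtain ⟨R, h1, h2, h3⟩ := h
  exact ⟨fun p => R (g p.1, p.2), h1.comp ((hg.comp Primrec.fst).pair Primrec.snd),
    fun a => h2 (g a), fun B a => h3 B (g a)⟩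

theorem EDef.and {S T : Set ℕ → α → Prop} (hS : EDef S) (hT : EDef T) :
    EDef fun B a => S B a ∧ T B a := by
  obtain ⟨R, h1, h2, h3⟩ := hS
  obtain ⟨R', h1', h2', h3'⟩ := hT
  refine ⟨fun p => R p ∧ R' p, h1.and h1', ?_, ?_⟩
  · intro a s s' v v' hs hv h
    exact ⟨h2 _ _ _ _ _ hs hv h.1, h2' _ _ _ _ _ hs hv h.2⟩
  · intro B a
    beta_reduce
    rw [h3, h3']
    constructor
    · rintro ⟨⟨s, v, h, hv⟩, s', v', h', hv'⟩
      refine ⟨max s s', v ||| v', ⟨h2 _ _ _ _ _ (le_max_left _ _) ?_ h,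
        h2' _ _ _ _ _ (le_max_right _ _) ?_ h'⟩, ?_⟩ <;> rw [finCode_or]
      · exact Set.subset_union_left
      · exact Set.subset_union_right
      · exact Set.union_subset hv hv'
    · rintro ⟨s, v, h, hv⟩
      exact ⟨⟨s, v, h.1, hv⟩, s, v, h.2, hv⟩

theorem EDef.or {S T : Set ℕ → α → Prop} (hS : EDef S) (hT : EDef T) :
    EDef fun B a => S B a ∨ T B a := by
  obtain ⟨R, h1, h2, h3⟩ := hS
  obtain ⟨R', h1', h2', h3'⟩ := hT
  refine ⟨fun p => R p ∨ R' p, h1.or h1', ?_, ?_⟩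
  · intro a s s' v v' hs hv h
    exact h.imp (h2 _ _ _ _ _ hs hv) (h2' _ _ _ _ _ hs hv)
  · intro B a
    beta_reduce
    rw [h3, h3']
    constructor
    · rintro (⟨s, v, h, hv⟩ | ⟨s, v, h, hv⟩)
      · exact ⟨s, v, Or.inl h, hv⟩
      · exact ⟨s, v, Or.inr h, hv⟩
    · rintro ⟨s, v, h | h, hv⟩
      · exact Or.inl ⟨s, v, h, hv⟩
      · exact Or.inr ⟨s, v, h, hv⟩

theorem EDef.ex {S : Set ℕ → α × ℕ → Prop} (hS : EDef S) :
    EDef fun B a => ∃ y, S B (a, y) := by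
  obtain ⟨R, h1, h2, h3⟩ := hS
  refine ⟨fun p => ∃ y < p.2.1, R ((p.1, y), p.2), ?_, ?_, ?_⟩
  · have : PrimrecRel fun (y : ℕ) (p : α × ℕ × ℕ) => R ((p.1, y), p.2) :=
      h1.comp (((Primrec.fst.comp Primrec.snd).pair Primrec.fst).pair (Primrec.snd.comp Primrec.snd))
    exact (rel_exists_lt this).comp (f := fun p : α × ℕ × ℕ => p.2.1) (g := fun p => p)
      (Primrec.fst.comp Primrec.snd) Primrec.id
  · rintro a s s' v v' hs hv ⟨y, hy, h⟩
    exact ⟨y, lt_of_lt_of_le hy hs, h2 _ _ _ _ _ hs hv h⟩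
  · intro B a
    constructor
    · rintro ⟨y, h⟩
      obtain ⟨s, v, h, hv⟩ := (h3 _ _).1 h
      exact ⟨max s (y + 1), v, ⟨y, by simp, h2 _ _ _ _ _ (le_max_left _ _) subset_rfl h⟩, hv⟩
    · rintro ⟨s, v, ⟨y, _, h⟩, hv⟩
      exact ⟨y, (h3 _ _).2 ⟨s, v, h, hv⟩⟩

/-- stage-wise enumeration of c.e. sets -/
def Stage (i s m : ℕ) : Prop :=
  (Nat.Partrec.Code.evaln s (Denumerable.ofNat Nat.Partrec.Code i) m).isSome = true

theorem Stage.mono {i s s' m : ℕ} (hs : s ≤ s') (h : Stage i s m) : Stage i s' m := by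
  unfold Stage at *
  obtain ⟨x, hx⟩ := Option.isSome_iff_exists.1 h
  exact Option.isSome_iff_exists.2 ⟨x, Nat.Partrec.Code.evaln_mono hs hx⟩

theorem mem_ceSet_iff {i m : ℕ} : m ∈ ceSet i ↔ ∃ s, Stage i s m := by
  unfold ceSet Stage
  simp only [Set.mem_ofPred_eq, Part.dom_iff_mem, Nat.Partrec.Code.evaln_complete]
  simp only [Option.isSome_iff_exists, Option.mem_def]
  exact exists_comm

theorem primrec_stage : PrimrecPred fun p : ℕ × ℕ × ℕ => Stage p.1 p.2.1 p.2.2 := by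
  refine Primrec.primrecPred (α := ℕ × ℕ × ℕ) ?_
  have : Primrec fun p : ℕ × ℕ × ℕ => (Nat.Partrec.Code.evaln p.2.1
      (Denumerable.ofNat Nat.Partrec.Code p.1) p.2.2).isSome :=
    Primrec.option_isSome.comp (Nat.Partrec.Code.primrec_evaln.comp
      (((Primrec.fst.comp Primrec.snd).pair ((Primrec.ofNat _).comp Primrec.fst)).pair
        (Primrec.snd.comp Primrec.snd)))
  refine this.of_eq fun p => ?_
  rw [Bool.eq_iff_iff, decide_eq_true_iff]
  rfl

/-- Parametrised composition with an enumeration operator. -/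
theorem EDef.op {S : Set ℕ → α × ℕ → Prop} (hS : EDef S) {i n : α → ℕ}
    (hi : Primrec i) (hn : Primrec n) :
    EDef fun B a => n a ∈ eOp (i a) {m | S B (a, m)} := by
  obtain ⟨R, h1, h2, h3⟩ := hS
  refine ⟨fun p => ∃ u < p.2.1, Stage (i p.1) p.2.1 (Nat.pair (n p.1) u) ∧
    ∀ x < u, (¬ u.testBit x = true ∨ R ((p.1, x), p.2)), ?_, ?_, ?_⟩
  · have hA : PrimrecRel fun (x : ℕ) (q : ℕ × (α × ℕ × ℕ)) =>
        (¬ q.1.testBit x = true ∨ R ((q.2.1, x), q.2.2)) := by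
      refine PrimrecPred.or (PrimrecPred.not (primrec_testBit.comp
        ((Primrec.fst.comp Primrec.snd).pair Primrec.fst))) (h1.comp ?_)
      exact (((Primrec.fst.comp (Primrec.snd.comp Primrec.snd)).pair Primrec.fst).pair
        (Primrec.snd.comp (Primrec.snd.comp Primrec.snd)))
    have hB : PrimrecRel fun (u : ℕ) (p : α × ℕ × ℕ) =>
        Stage (i p.1) p.2.1 (Nat.pair (n p.1) u) ∧
          ∀ x < u, (¬ u.testBit x = true ∨ R ((p.1, x), p.2)) := by
      refine PrimrecPred.and (primrec_stage.comp
        (f := fun q : ℕ × (α × ℕ × ℕ) => (i q.2.1, q.2.2.1, Nat.pair (n q.2.1) q.1)) ?_) ((rel_forall_lt hA).comp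
        (f := fun q : ℕ × (α × ℕ × ℕ) => q.1) (g := fun q => q) Primrec.fst Primrec.id)
      exact (hi.comp (Primrec.fst.comp Primrec.snd)).pair
        ((Primrec.fst.comp (Primrec.snd.comp Primrec.snd)).pair
          (Primrec₂.natPair.comp (hn.comp (Primrec.fst.comp Primrec.snd)) Primrec.fst))
    exact (rel_exists_lt hB).comp (f := fun p : α × ℕ × ℕ => p.2.1) (g := fun p => p)
      (Primrec.fst.comp Primrec.snd) Primrec.id
  · rintro a s s' v v' hs hv ⟨u, hu, hst, h⟩
    exact ⟨u, lt_of_lt_of_le hu hs, hst.mono hs, fun x hx =>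
      (h x hx).imp id (h2 _ _ _ _ _ hs hv)⟩
  · intro B a
    constructor
    · rintro ⟨u, hu, hsub⟩
      obtain ⟨s0, hs0⟩ := mem_ceSet_iff.1 hu
      have key : ∀ N, ∃ s v, finCode v ⊆ B ∧
          ∀ x < N, (¬ u.testBit x = true ∨ R ((a, x), s, v)) := by
        intro N
        induction N with
        | zero => exact ⟨0, 0, by simp [finCode_zero], by simp⟩
        | succ N ih =>
          obtain ⟨s, v, hv, h⟩ := ih
          by_cases hb : u.testBit N = true
          · obtain ⟨s', v', h', hv'⟩ := (h3 _ _).1 (hsub hb)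
            refine ⟨max s s', v ||| v', ?_, ?_⟩
            · rw [finCode_or]; exact Set.union_subset hv hv'
            · intro x hx
              rcases Nat.lt_succ_iff_lt_or_eq.1 hx with hx | rfl
              · refine (h x hx).imp id (h2 _ _ _ _ _ (le_max_left _ _) ?_)
                rw [finCode_or]; exact Set.subset_union_left
              · refine Or.inr (h2 _ _ _ _ _ (le_max_right _ _) ?_ h')
                rw [finCode_or]; exact Set.subset_union_right
          · refine ⟨s, v, hv, fun x hx => ?_⟩
            rcases Nat.lt_succ_iff_lt_or_eq.1 hx with hx | rfl
            · exact h x hx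
            · exact Or.inl hb
      obtain ⟨s, v, hv, h⟩ := key u
      refine ⟨max (max s s0) (u + 1), v, ⟨u, by simp, hs0.mono (by simp), ?_⟩, hv⟩
      intro x hx
      exact (h x hx).imp id (h2 _ _ _ _ _ (by simp) subset_rfl)
    · rintro ⟨s, v, ⟨u, _, hst, h⟩, hv⟩
      refine ⟨u, mem_ceSet_iff.2 ⟨s, hst⟩, fun x hx => ?_⟩
      rcases h x (lt_of_mem_finCode hx) with h | h
      · exact absurd hx h
      · exact (h3 _ _).2 ⟨s, v, h, hv⟩

/-- Composition with the operator applied to the parameter set itself. -/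
theorem EDef.op0 {i n : α → ℕ} (hi : Primrec i) (hn : Primrec n) :
    EDef fun B a => n a ∈ eOp (i a) B :=
  (EDef.op (EDef.mem Primrec.snd) hi hn).of_iff fun _ _ => Iff.rfl

end closure

theorem EDef.index {S : Set ℕ → ℕ → Prop} (hS : EDef S) : ∃ i, ∀ B, {n | S B n} = eOp i B := by
  obtain ⟨R, h1, -, h3⟩ := hS
  have hp : Partrec fun m : ℕ => Nat.rfind fun s =>
      Part.some (decide (R (m.unpair.1, s, m.unpair.2))) := by
    refine Partrec.rfind ?_
    have : Computable fun q : ℕ × ℕ => decide (R (q.1.unpair.1, q.2, q.1.unpair.2)) := by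
      refine Primrec.to_comp (PrimrecPred.decide (h1.comp ?_))
      exact (Primrec.fst.comp (Primrec.unpair.comp Primrec.fst)).pair
        (Primrec.snd.pair (Primrec.snd.comp (Primrec.unpair.comp Primrec.fst)))
    exact this.partrec
  obtain ⟨c, hc⟩ := Nat.Partrec.Code.exists_code.1 (Partrec.nat_iff.1 hp)
  refine ⟨Encodable.encode c, fun B => ?_⟩
  have hmem : ∀ m, m ∈ ceSet (Encodable.encode c) ↔ ∃ s, R (m.unpair.1, s, m.unpair.2) := by
    intro m
    unfold ceSet
    rw [Set.mem_ofPred_eq, Denumerable.ofNat_encode, hc]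
    beta_reduce
    refine Nat.rfind_dom.trans ?_
    simp
  ext n
  simp only [Set.mem_ofPred_eq, eOp, h3, hmem, Nat.unpair_pair]
  constructor
  · rintro ⟨s, v, h, hv⟩
    exact ⟨v, ⟨s, h⟩, hv⟩
  · rintro ⟨v, ⟨s, h⟩, hv⟩
    exact ⟨s, v, h, hv⟩

/-- s-m-n for enumeration operators. -/
theorem EDef.smn {S : Set ℕ → ℕ × ℕ → Prop} (hS : EDef S) :
    ∃ g : ℕ → ℕ, Primrec g ∧ ∀ B a, {n | S B (a, n)} = eOp (g a) B := by
  obtain ⟨R, h1, -, h3⟩ := hS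
  have hp : Partrec fun m : ℕ => Nat.rfind fun s =>
      Part.some (decide (R ((m.unpair.1, m.unpair.2.unpair.1), s, m.unpair.2.unpair.2))) := by
    refine Partrec.rfind ?_
    have : Computable fun q : ℕ × ℕ => decide (R ((q.1.unpair.1, q.1.unpair.2.unpair.1), q.2,
        q.1.unpair.2.unpair.2)) := by
      refine Primrec.to_comp (PrimrecPred.decide (h1.comp ?_))
      have h2 : Primrec fun q : ℕ × ℕ => q.1.unpair.2.unpair :=
        Primrec.unpair.comp (Primrec.snd.comp (Primrec.unpair.comp Primrec.fst))
      exact ((Primrec.fst.comp (Primrec.unpair.comp Primrec.fst)).pair (Primrec.fst.comp h2)).pair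
        (Primrec.snd.pair (Primrec.snd.comp h2))
    exact this.partrec
  obtain ⟨c, hc⟩ := Nat.Partrec.Code.exists_code.1 (Partrec.nat_iff.1 hp)
  refine ⟨fun a => Encodable.encode (Nat.Partrec.Code.curry c a),
    Primrec.encode.comp (Nat.Partrec.Code.primrec₂_curry.comp (Primrec.const c) Primrec.id),
    fun B a => ?_⟩
  have hmem : ∀ m, m ∈ ceSet (Encodable.encode (Nat.Partrec.Code.curry c a)) ↔
      ∃ s, R ((a, m.unpair.1), s, m.unpair.2) := by
    intro m
    unfold ceSet
    rw [Set.mem_ofPred_eq, Denumerable.ofNat_encode, Nat.Partrec.Code.eval_curry, hc]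
    beta_reduce
    refine Nat.rfind_dom.trans ?_
    simp
  ext n
  simp only [Set.mem_ofPred_eq, eOp, h3, hmem, Nat.unpair_pair]
  constructor
  · rintro ⟨s, v, h, hv⟩
    exact ⟨v, ⟨s, h⟩, hv⟩
  · rintro ⟨v, ⟨s, h⟩, hv⟩
    exact ⟨s, v, h, hv⟩

theorem iter_index (c : ℕ) : ∃ p : ℕ → ℕ, Primrec p ∧ ∀ B t, eOp (p t) B = (eOp c)^[t] B := by
  have hid : EDef fun (B : Set ℕ) (n : ℕ) => n ∈ B := EDef.mem Primrec.id
  obtain ⟨i0, hi0⟩ := hid.index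
  have hcomp : EDef fun (B : Set ℕ) (a : ℕ × ℕ) => a.2 ∈ eOp c {m | m ∈ eOp a.1 B} :=
    EDef.op (S := fun B (q : (ℕ × ℕ) × ℕ) => q.2 ∈ eOp q.1.1 B)
      (EDef.op0 (Primrec.fst.comp Primrec.fst) Primrec.snd) (Primrec.const c) Primrec.snd
  obtain ⟨g, hg, hgs⟩ := hcomp.smn
  refine ⟨fun t => g^[t] i0, ?_, ?_⟩
  · exact Primrec.nat_iterate Primrec.id (Primrec.const i0) (hg.comp Primrec.snd).to₂
  · intro B t
    induction t with
    | zero => exact (hi0 B).symm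
    | succ t ih =>
      beta_reduce at ih ⊢
      rw [Function.iterate_succ_apply', Function.iterate_succ_apply', ← hgs, ← ih]
      rfl

theorem ELe.of_edef {S : Set ℕ → ℕ → Prop} (hS : EDef S) {A B : Set ℕ} (h : ∀ n, n ∈ A ↔ S B n) :
    ELe A B := by
  obtain ⟨i, hi⟩ := hS.index
  refine ⟨i, ?_⟩
  unfold ELeVia
  rw [← hi]; ext n; exact h n

theorem ele_trans {A B C : Set ℕ} (h1 : ELe A B) (h2 : ELe B C) : ELe A C := by
  obtain ⟨i, rfl⟩ := h1
  obtain ⟨j, rfl⟩ := h2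
  exact ELe.of_edef (S := fun C n => n ∈ eOp i {m | m ∈ eOp j C})
    (EDef.op (S := fun B (q : ℕ × ℕ) => q.2 ∈ eOp j B)
      (EDef.op0 (Primrec.const j) Primrec.snd) (Primrec.const i) Primrec.id) fun n => Iff.rfl

/-- `{n} × C`. -/
def tag (n : ℕ) (C : Set ℕ) : Set ℕ := {y | y.unpair.1 = n ∧ y.unpair.2 ∈ C}

theorem pair_mem_tag {m n x : ℕ} {C : Set ℕ} : Nat.pair m x ∈ tag n C ↔ m = n ∧ x ∈ C := by
  simp [tag]

theorem prim_u1 : Primrec fun y : ℕ => y.unpair.1 := Primrec.fst.comp Primrec.unpair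
theorem prim_u2 : Primrec fun y : ℕ => y.unpair.2 := Primrec.snd.comp Primrec.unpair

/-- retagging has indices that depend only on the source and target tags -/
theorem untag_index (a : ℕ) : ∃ i j, ∀ X, EEquivVia (tag a X) X i j := by
  obtain ⟨i, hi⟩ := EDef.index (S := fun B y => y.unpair.1 = a ∧ y.unpair.2 ∈ B)
    ((EDef.pure (Primrec.eq.comp prim_u1 (Primrec.const a))).and (EDef.mem prim_u2))
  obtain ⟨j, hj⟩ := EDef.index (S := fun B y => Nat.pair a y ∈ B)
    (EDef.mem (Primrec₂.natPair.comp (Primrec.const a) Primrec.id))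
  refine ⟨i, j, fun X => ⟨(hi X), ?_⟩⟩
  unfold ELeVia
  rw [← hj]; ext y; simp [pair_mem_tag]

theorem shift_index : ∃ i j, ∀ n X, EEquivVia (tag n X) (tag (n + 1) X) i j := by
  obtain ⟨i, hi⟩ := EDef.index (S := fun B y => Nat.pair (y.unpair.1 + 1) y.unpair.2 ∈ B)
    (EDef.mem (Primrec₂.natPair.comp (Primrec.succ.comp prim_u1) prim_u2))
  obtain ⟨j, hj⟩ := EDef.index
    (S := fun B y => ¬ y.unpair.1 = 0 ∧ Nat.pair (y.unpair.1 - 1) y.unpair.2 ∈ B)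
    ((EDef.pure (PrimrecPred.not (Primrec.eq.comp prim_u1 (Primrec.const 0)))).and
      (EDef.mem (Primrec₂.natPair.comp (Primrec.pred.comp prim_u1) prim_u2)))
  refine ⟨i, j, fun n X => ⟨?_, ?_⟩⟩
  · unfold ELeVia
    rw [← hi]; ext y; simp only [Set.mem_ofPred_eq, pair_mem_tag]; simp [tag]
  · unfold ELeVia
    rw [← hj]; ext y; simp only [Set.mem_ofPred_eq, pair_mem_tag]; simp only [tag, Set.mem_ofPred_eq]
    constructor
    · rintro ⟨h, h'⟩; exact ⟨by omega, by omega, h'⟩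
    · rintro ⟨h, h', h''⟩; exact ⟨by omega, h''⟩

theorem pair_fun_prim : Primrec fun q : ℕ × ℕ => Nat.pair q.1.unpair.1 q.2 :=
  Primrec₂.natPair.comp (prim_u1.comp Primrec.fst) Primrec.snd

theorem slice_edef (p : ℕ) :
    EDef fun (B : Set ℕ) (y : ℕ) => y.unpair.2 ∈ eOp p {z | Nat.pair y.unpair.1 z ∈ B} :=
  EDef.op (S := fun B (q : ℕ × ℕ) => Nat.pair q.1.unpair.1 q.2 ∈ B)
    (EDef.mem pair_fun_prim) (Primrec.const p) prim_u2

theorem slice_nonempty :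
    EDef fun (B : Set ℕ) (y : ℕ) => ∃ z, Nat.pair y.unpair.1 z ∈ B :=
  EDef.ex (S := fun B (q : ℕ × ℕ) => Nat.pair q.1.unpair.1 q.2 ∈ B) (EDef.mem pair_fun_prim)

theorem slice_tag (n : ℕ) (X : Set ℕ) : {z | Nat.pair n z ∈ tag n X} = X := by
  ext z; simp [pair_mem_tag]

/-- The switch `W_n`, equal to `Q` if `n ∈ C` and to `P` otherwise. -/
def sw (C P Q : Set ℕ) (n : ℕ) : Set ℕ := {y | y ∈ P ∨ (n ∈ C ∧ y ∈ Q)}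

theorem sw_index (C P Q : Set ℕ) (p q d : ℕ) (hPQ : P ⊆ Q) (hP0 : P.Nonempty) (hC0 : C.Nonempty)
    (hP : P = eOp p C) (hQ : Q = eOp q C) (hdP : C = eOp d P) (hdQ : C = eOp d Q) :
    ∃ i j, ∀ n, EEquivVia (tag n C) (tag n (sw C P Q n)) i j := by
  obtain ⟨i, hi⟩ := EDef.index (slice_nonempty.and (slice_edef d))
  obtain ⟨j, hj⟩ := EDef.index (slice_nonempty.and ((slice_edef p).or
    ((EDef.mem (Primrec₂.natPair.comp prim_u1 prim_u1)).and (slice_edef q))))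
  refine ⟨i, j, fun n => ⟨?_, ?_⟩⟩
  · unfold ELeVia
    rw [← hi]; ext y
    have hw : eOp d (sw C P Q n) = C := by
      by_cases hn : n ∈ C
      · have : sw C P Q n = Q := by
          ext y; simp only [sw, Set.mem_ofPred_eq, hn, true_and]
          exact ⟨fun h => h.elim (fun h => hPQ h) id, Or.inr⟩
        rw [this, ← hdQ]
      · have : sw C P Q n = P := by
          ext y; simp [sw, hn]
        rw [this, ← hdP]
    have hne : ∃ z, z ∈ sw C P Q n := hP0.imp fun z hz => Or.inl hz
    by_cases hy : y.unpair.1 = n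
    · simp only [Set.mem_ofPred_eq, hy, slice_tag, hw]
      simp [tag, pair_mem_tag, hy, hne]
    · simp [tag, pair_mem_tag, hy]
  · unfold ELeVia
    rw [← hj]; ext y
    have hne : ∃ z, z ∈ C := hC0
    by_cases hy : y.unpair.1 = n
    · simp only [Set.mem_ofPred_eq, hy, slice_tag, ← hP, ← hQ]
      simp [tag, pair_mem_tag, hy, hne, sw]
    · simp [tag, pair_mem_tag, hy]

theorem switch_reduce (f : Set ℕ → Set ℕ) (hf : UniformlyEInvariant f)
    (C P Q : Set ℕ) (p q d : ℕ) (hPQ : P ⊆ Q) (hP0 : P.Nonempty) (hC0 : C.Nonempty)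
    (hP : P = eOp p C) (hQ : Q = eOp q C) (hdP : C = eOp d P) (hdQ : C = eOp d Q) (k : ℕ) :
    ELe {n | k ∈ f (sw C P Q n)} (f (tag 0 C)) := by
  obtain ⟨u, hu⟩ := hf
  have hu' : ∀ i j, ∃ a b, ∀ A B, EEquivVia A B i j → f A = eOp a (f B) ∧ f B = eOp b (f A) :=
    fun i j => ⟨_, _, fun A B h => hu A (Set.mem_univ _) B (Set.mem_univ _) i j h⟩
  obtain ⟨i1, j1, h1⟩ := shift_index
  obtain ⟨b, a, hab⟩ := hu' i1 j1
  obtain ⟨i2, j2, h2⟩ := sw_index C P Q p q d hPQ hP0 hC0 hP hQ hdP hdQ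
  obtain ⟨_, g, hg⟩ := hu' i2 j2
  obtain ⟨i3, j3, h3⟩ := untag_index 0
  obtain ⟨_, e, he⟩ := hu' i3 j3
  obtain ⟨pa, hpa, hpas⟩ := iter_index a
  obtain ⟨pb, hpb, hpbs⟩ := iter_index b
  have up : ∀ n X, f (tag n X) = eOp (pa n) (f (tag 0 X)) := by
    intro n X
    rw [hpas]
    induction n with
    | zero => rfl
    | succ n ih => rw [Function.iterate_succ_apply', ← ih]; exact (hab _ _ (h1 n X)).2
  have down : ∀ n X, f (tag 0 X) = eOp (pb n) (f (tag n X)) := by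
    intro n X
    rw [hpbs]
    induction n with
    | zero => rfl
    | succ n ih => rw [Function.iterate_succ_apply, ← (hab _ _ (h1 n X)).1]; exact ih
  refine ELe.of_edef (S := fun B n => k ∈ eOp e {m1 | m1 ∈ eOp (pb n) {m2 | m2 ∈ eOp g
    {m3 | m3 ∈ eOp (pa n) B}}}) ?_ ?_
  · refine EDef.op (S := fun B (q : ℕ × ℕ) => q.2 ∈ eOp (pb q.1) {m2 | m2 ∈ eOp g
      {m3 | m3 ∈ eOp (pa q.1) B}}) ?_ (Primrec.const e) (Primrec.const k)
    refine EDef.op (S := fun B (q : (ℕ × ℕ) × ℕ) => q.2 ∈ eOp g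
      {m3 | m3 ∈ eOp (pa q.1.1) B}) ?_ (hpb.comp Primrec.fst) Primrec.snd
    refine EDef.op (S := fun B (q : ((ℕ × ℕ) × ℕ) × ℕ) => q.2 ∈ eOp (pa q.1.1.1) B) ?_
      (Primrec.const g) Primrec.snd
    exact EDef.op0 (hpa.comp (Primrec.fst.comp (Primrec.fst.comp Primrec.fst))) Primrec.snd
  · intro n
    show k ∈ f (sw C P Q n) ↔ k ∈ eOp e (eOp (pb n) (eOp g (eOp (pa n) (f (tag 0 C)))))
    rw [← up, ← (hg _ _ (h2 n)).2, ← down, ← (he _ _ (h3 _)).2]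

theorem einv (f : Set ℕ → Set ℕ) (hf : UniformlyEInvariant f) {A B : Set ℕ} (h : EEquiv A B) :
    EEquiv (f A) (f B) := by
  obtain ⟨u, hu⟩ := hf
  obtain ⟨⟨i, hi⟩, ⟨j, hj⟩⟩ := h
  have := hu A (Set.mem_univ _) B (Set.mem_univ _) i j ⟨hi, hj⟩
  exact ⟨⟨_, this.1⟩, ⟨_, this.2⟩⟩

theorem kset_le (A : Set ℕ) : ELe (KSet A) A :=
  ELe.of_edef (S := fun B n => n.unpair.2 ∈ eOp n.unpair.1 B) (EDef.op0 prim_u1 prim_u2)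
    fun n => Iff.rfl

theorem ele_refl (A : Set ℕ) : ELe A A :=
  ELe.of_edef (S := fun B n => n ∈ B) (EDef.mem Primrec.id) fun n => Iff.rfl

theorem le_kset (A : Set ℕ) : ELe A (KSet A) := by
  obtain ⟨i, hi⟩ := ele_refl A
  refine ELe.of_edef (S := fun B n => Nat.pair i n ∈ B)
    (EDef.mem (Primrec₂.natPair.comp (Primrec.const i) Primrec.id)) fun n => ?_
  simp only [KSet, Set.mem_ofPred_eq, Nat.unpair_pair]
  rw [← hi]

theorem not_skip_le (A : Set ℕ) : ¬ ELe (KSet A)ᶜ A := by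
  intro h
  have h2 : ELe {n | Nat.pair n n ∈ (KSet A)ᶜ} A := by
    refine ele_trans ?_ h
    exact ELe.of_edef (S := fun B n => Nat.pair n n ∈ B)
      (EDef.mem (Primrec₂.natPair.comp Primrec.id Primrec.id)) fun n => Iff.rfl
  obtain ⟨j, hj⟩ := h2
  have h3 : j ∈ {n | Nat.pair n n ∈ (KSet A)ᶜ} ↔ j ∈ eOp j A := by
    conv_lhs => rw [hj]
  simp [KSet] at h3

theorem ele_empty {A B : Set ℕ} (h : ELe A ∅) : ELe A B := by
  refine ele_trans h ?_
  exact ELe.of_edef (S := fun _ n => ¬ n = n)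
    (EDef.pure (PrimrecPred.not (Primrec.eq.comp Primrec.id Primrec.id))) fun n => by simp

theorem tag_equiv (a : ℕ) (X : Set ℕ) : EEquiv (tag a X) X := by
  obtain ⟨i, j, h⟩ := untag_index a
  exact ⟨⟨i, (h X).1⟩, ⟨j, (h X).2⟩⟩

theorem eequiv_trans {A B C : Set ℕ} (h1 : EEquiv A B) (h2 : EEquiv B C) : EEquiv A C :=
  ⟨ele_trans h1.1 h2.1, ele_trans h2.2 h1.2⟩

theorem join_le {a b : ℕ} {X Y C : Set ℕ} (hX : ELe X C) (hY : ELe Y C) :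
    ELe (tag a X ∪ tag b Y) C := by
  obtain ⟨i, hi⟩ := ele_trans (tag_equiv a X).1 hX
  obtain ⟨j, hj⟩ := ele_trans (tag_equiv b Y).1 hY
  refine ELe.of_edef (S := fun B n => n ∈ eOp i B ∨ n ∈ eOp j B)
    ((EDef.op0 (Primrec.const i) Primrec.id).or (EDef.op0 (Primrec.const j) Primrec.id)) fun n => ?_
  rw [← hi, ← hj]; rfl

theorem join_eq (f : Set ℕ → Set ℕ) (hf : UniformlyEInvariant f) {A X Y : Set ℕ}
    (hA : ELt (f A) A) (hX : EEquiv A X) (hY : EEquiv A Y) {a b : ℕ} (hab : a ≠ b) :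
    f (tag a X) = f (tag a X ∪ tag b Y) := by
  have nonempty : ∀ Z, ELe A Z → Z.Nonempty := by
    intro Z hZ
    rw [Set.nonempty_iff_ne_empty]
    rintro rfl
    exact hA.2 (ele_empty hZ)
  set C := KSet A with hC
  set P := tag a X with hPdef
  set Q := tag a X ∪ tag b Y with hQdef
  have hCX : ELe C X := ele_trans (kset_le A) hX.1
  obtain ⟨c, hc⟩ := hCX
  obtain ⟨d, hd⟩ := EDef.index (S := fun B n => n ∈ eOp c {z | Nat.pair a z ∈ B})
    (EDef.op (S := fun B (q : ℕ × ℕ) => Nat.pair a q.2 ∈ B)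
      (EDef.mem (Primrec₂.natPair.comp (Primrec.const a) Primrec.snd))
      (Primrec.const c) Primrec.id)
  have hdP : C = eOp d P := by
    rw [← hd, hPdef, slice_tag]; exact hc
  have hdQ : C = eOp d Q := by
    have : {z | Nat.pair a z ∈ Q} = X := by
      ext z; simp [hQdef, pair_mem_tag, hab]
    rw [← hd, this]; exact hc
  have hXC : ELe X C := ele_trans hX.2 (le_kset A)
  have hYC : ELe Y C := ele_trans hY.2 (le_kset A)
  obtain ⟨p, hp⟩ : ELe P C := ele_trans (tag_equiv a X).1 hXC
  obtain ⟨q, hq⟩ : ELe Q C := join_le hXC hYC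
  have hPQ : P ⊆ Q := Set.subset_union_left
  have hP0 : P.Nonempty := nonempty P (ele_trans hX.1 (tag_equiv a X).2)
  have hC0 : C.Nonempty := nonempty C (le_kset A)
  have hCA : EEquiv (f (tag 0 C)) (f A) :=
    einv f hf (eequiv_trans (tag_equiv 0 C) ⟨kset_le A, le_kset A⟩)
  have hin : ∀ n, n ∈ C → sw C P Q n = Q := by
    intro n hn
    ext y; simp only [sw, Set.mem_ofPred_eq, hn, true_and]
    exact ⟨fun h => h.elim (fun h => hPQ h) id, Or.inr⟩
  have hout : ∀ n, n ∉ C → sw C P Q n = P := by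
    intro n hn
    ext y; simp [sw, hn]
  have red := fun k => ele_trans
    (switch_reduce f hf C P Q p q d hPQ hP0 hC0 hp hq hdP hdQ k) hCA.1
  ext k
  constructor
  · intro hk
    by_contra hk'
    have : {n | k ∈ f (sw C P Q n)} = Cᶜ := by
      ext n
      by_cases hn : n ∈ C
      · simp [hin n hn, hn, hk']
      · simp [hout n hn, hn, hk]
    have h := red k
    rw [this] at h
    exact not_skip_le A (ele_trans h hA.1)
  · intro hk
    by_contra hk'
    have : {n | k ∈ f (sw C P Q n)} = C := by
      ext n
      by_cases hn : n ∈ C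
      · simp [hin n hn, hn, hk]
      · simp [hout n hn, hn, hk']
    have h := red k
    rw [this] at h
    exact hA.2 (ele_trans (le_kset A) h)

theorem const_on_degree (f : Set ℕ → Set ℕ) (hf : UniformlyEInvariant f) {A X Y : Set ℕ}
    (hA : ELt (f A) A) (hX : EEquiv A X) (hY : EEquiv A Y) : f X = f Y := by
  have h1 : f (tag 0 X) = f (tag 0 Y) := by
    rw [join_eq f hf hA hX hY (zero_ne_one), Set.union_comm,
      ← join_eq f hf hA hY hX (one_ne_zero), join_eq f hf hA hY hY (one_ne_zero), Set.union_comm,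
      ← join_eq f hf hA hY hY (zero_ne_one)]
  obtain ⟨u, hu⟩ := hf
  obtain ⟨i, j, h⟩ := untag_index 0
  have hx := (hu _ (Set.mem_univ _) _ (Set.mem_univ _) i j (h X)).2
  have hy := (hu _ (Set.mem_univ _) _ (Set.mem_univ _) i j (h Y)).2
  unfold ELeVia at hx hy
  rw [hx, hy, h1]

end EUnif

/-- If `f` is uniformly e-invariant and `f(A) <ₑ A`, then `f` is constant on
`deg_e(A)`.  Consequently, every regressive uniformly e-invariant function is
locally constant, i.e. constant on every enumeration degree. -/
theorem regressive_uniform_locally_constant (f : Set ℕ → Set ℕ)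
    (hf : UniformlyEInvariant f) :
    (∀ A : Set ℕ, ELt (f A) A → ∀ X ∈ edeg A, ∀ Y ∈ edeg A, f X = f Y) ∧
    ((∀ A : Set ℕ, ELt (f A) A) → ∀ A : Set ℕ, ∀ X ∈ edeg A, ∀ Y ∈ edeg A, f X = f Y) := by
  have key : ∀ A : Set ℕ, ELt (f A) A → ∀ X ∈ edeg A, ∀ Y ∈ edeg A, f X = f Y :=
    fun A hA X hX Y hY => EUnif.const_on_degree f hf hA hX hY
  exact ⟨key, fun h A => key A (h A)⟩
end

section
/- Let A, B, U ⊆ ℕ be such that {A, B} is a nontrivial K_U-pair and U <_e A. Then every uniformly e-invariant function f defined on deg_e(A) that satisfies f(A) ≡_e B is constant on deg_e(A). -/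
open Classical

/-- `{A, B}` is a `K_U`-pair: there is `W ≤ₑ U` with `A × B ⊆ W` and
`Aᶜ × Bᶜ ⊆ Wᶜ` (under the standard pairing). -/
def KPair (U A B : Set ℕ) : Prop :=
  ∃ W : Set ℕ, ELe W U ∧
    (∀ a ∈ A, ∀ b ∈ B, Nat.pair a b ∈ W) ∧
    (∀ a ∉ A, ∀ b ∉ B, Nat.pair a b ∉ W)

/-- The `K_U`-pair `{A, B}` is nontrivial: `A ≰ₑ U` and `B ≰ₑ U`. -/
def NontrivialKPair (U A B : Set ℕ) : Prop :=
  KPair U A B ∧ ¬ ELe A U ∧ ¬ ELe B U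


/-- A positive (enumeration) predicate, in normal form. -/
def EPos {α : Type} [Primcodable α] (P : α → Set ℕ → Prop) : Prop :=
  ∃ L : α × ℕ → Option (List ℕ), Primrec L ∧
    ∀ a X, P a X ↔ ∃ w l, L (a, w) = some l ∧ ∀ x ∈ l, x ∈ X

section machinery
variable {α β : Type} [Primcodable α] [Primcodable β]

theorem EPos.congr {P Q : α → Set ℕ → Prop} (h : EPos P) (e : ∀ a X, Q a X ↔ P a X) : EPos Q := by
  obtain ⟨L, hL, h⟩ := h
  exact ⟨L, hL, fun a X => (e a X).trans (h a X)⟩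

theorem EPos.subst {P : α → Set ℕ → Prop} (h : EPos P) {f : β → α} (hf : Primrec f) :
    EPos (fun b X => P (f b) X) := by
  obtain ⟨L, hL, h⟩ := h
  exact ⟨fun p => L (f p.1, p.2), hL.comp ((hf.comp Primrec.fst).pair Primrec.snd),
    fun a X => h (f a) X⟩

theorem EPos.mem {f : α → ℕ} (hf : Primrec f) : EPos (fun a X => f a ∈ X) :=
  ⟨fun p => some [f p.1], Primrec.option_some.comp
    (Primrec.list_cons.comp (hf.comp Primrec.fst) (Primrec.const [])), fun a X => by simp⟩

theorem EPos.dec {p : α → Prop} (hp : PrimrecPred p) : EPos (fun a _ => p a) := by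
  obtain ⟨_, _⟩ := id hp
  refine ⟨fun q => if p q.1 then some [] else none,
    Primrec.ite (hp.comp Primrec.fst) (Primrec.const _) (Primrec.const _), fun a X => ?_⟩
  by_cases h : p a <;> simp [h]

theorem EPos.and {P Q : α → Set ℕ → Prop} (hP : EPos P) (hQ : EPos Q) :
    EPos (fun a X => P a X ∧ Q a X) := by
  obtain ⟨L, hL, h⟩ := hP
  obtain ⟨M, hM, k⟩ := hQ
  refine ⟨fun q => (L (q.1, q.2.unpair.1)).bind fun l => (M (q.1, q.2.unpair.2)).map fun m => l ++ m,
    ?_, fun a X => ?_⟩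
  · refine Primrec.option_bind (hL.comp (Primrec.fst.pair
      (Primrec.fst.comp (Primrec.unpair.comp Primrec.snd)))) ?_
    refine Primrec.option_map (hM.comp ((Primrec.fst.comp Primrec.fst).pair
      (Primrec.snd.comp (Primrec.unpair.comp (Primrec.snd.comp Primrec.fst))))) ?_
    exact Primrec.list_append.comp (Primrec.snd.comp Primrec.fst) Primrec.snd
  · beta_reduce
    rw [h, k]
    constructor
    · rintro ⟨⟨w, l, h1, h2⟩, v, m, h3, h4⟩
      refine ⟨Nat.pair w v, l ++ m, by simp [h1, h3], ?_⟩
      intro x hx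
      rcases List.mem_append.1 hx with hx | hx
      · exact h2 x hx
      · exact h4 x hx
    · rintro ⟨w, l, h1, h2⟩
      simp only [Option.bind_eq_some_iff, Option.map_eq_some_iff] at h1
      obtain ⟨l1, e1, l2, e2, rfl⟩ := h1
      exact ⟨⟨_, _, e1, fun x hx => h2 x (List.mem_append_left _ hx)⟩,
        ⟨_, _, e2, fun x hx => h2 x (List.mem_append_right _ hx)⟩⟩

theorem EPos.or {P Q : α → Set ℕ → Prop} (hP : EPos P) (hQ : EPos Q) :
    EPos (fun a X => P a X ∨ Q a X) := by
  obtain ⟨L, hL, h⟩ := hP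
  obtain ⟨M, hM, k⟩ := hQ
  refine ⟨fun q => if q.2.unpair.1 = 0 then L (q.1, q.2.unpair.2) else M (q.1, q.2.unpair.2),
    ?_, fun a X => ?_⟩
  · have e : Primrec fun q : α × ℕ => (q.1, q.2.unpair.2) :=
      Primrec.fst.pair (Primrec.snd.comp (Primrec.unpair.comp Primrec.snd))
    exact Primrec.ite (Primrec.eq.comp (Primrec.fst.comp (Primrec.unpair.comp Primrec.snd))
      (Primrec.const 0)) (hL.comp e) (hM.comp e)
  · beta_reduce
    rw [h, k]
    constructor
    · rintro (⟨w, l, h1, h2⟩ | ⟨w, l, h1, h2⟩)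
      · exact ⟨Nat.pair 0 w, l, by simp [h1], h2⟩
      · exact ⟨Nat.pair 1 w, l, by simp [h1], h2⟩
    · rintro ⟨w, l, h1, h2⟩
      by_cases e : w.unpair.1 = 0
      · simp only [e, if_true] at h1
        exact Or.inl ⟨_, _, h1, h2⟩
      · simp only [e, if_false] at h1
        exact Or.inr ⟨_, _, h1, h2⟩

theorem EPos.ex {P : α × ℕ → Set ℕ → Prop} (hP : EPos P) :
    EPos (fun a X => ∃ y, P (a, y) X) := by
  obtain ⟨L, hL, h⟩ := hP
  refine ⟨fun q => L ((q.1, q.2.unpair.1), q.2.unpair.2), hL.comp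
    ((Primrec.fst.pair (Primrec.fst.comp (Primrec.unpair.comp Primrec.snd))).pair
      (Primrec.snd.comp (Primrec.unpair.comp Primrec.snd))), fun a X => ?_⟩
  constructor
  · rintro ⟨y, hy⟩
    obtain ⟨w, l, h1, h2⟩ := (h _ _).1 hy
    exact ⟨Nat.pair y w, l, by simp [h1], h2⟩
  · rintro ⟨w, l, h1, h2⟩
    exact ⟨w.unpair.1, (h _ _).2 ⟨_, _, h1, h2⟩⟩

theorem EPos.ball {P : α → Set ℕ → Prop} (hP : EPos P) :
    EPos (fun (g : List α) X => ∀ b ∈ g, P b X) := by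
  obtain ⟨L, hL, h⟩ := hP
  let F : Option (List ℕ) × ℕ → α → Option (List ℕ) × ℕ := fun s b =>
    (s.1.bind fun l => (L (b, s.2.unpair.1)).map fun m => m ++ l, s.2.unpair.2)
  refine ⟨fun q => (q.1.foldl F (some [], q.2)).1, ?_, fun g X => ?_⟩
  · refine Primrec.fst.comp ?_
    refine Primrec.list_foldl (h := fun _ p => F p.1 p.2) Primrec.fst
      ((Primrec.const _).pair Primrec.snd) ?_
    have e1 : Primrec fun x : (List α × ℕ) × (Option (List ℕ) × ℕ) × α => x.2.1.2.unpair :=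
      Primrec.unpair.comp (Primrec.snd.comp (Primrec.fst.comp Primrec.snd))
    refine Primrec.pair ?_ (Primrec.snd.comp e1)
    refine Primrec.option_bind (Primrec.fst.comp (Primrec.fst.comp Primrec.snd)) ?_
    refine Primrec.option_map (hL.comp (((Primrec.snd.comp Primrec.snd).pair
      (Primrec.fst.comp e1)).comp Primrec.fst)) ?_
    exact Primrec.list_append.comp Primrec.snd (Primrec.snd.comp Primrec.fst)
  · have none_fold : ∀ (g : List α) (w : ℕ), (g.foldl F (none, w)).1 = none := by
      intro g
      induction g with
      | nil => intro w; rfl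
      | cons b g ih => intro w; exact ih _
    have key : ∀ (g : List α) (l : List ℕ), ((∀ b ∈ g, P b X) ∧ ∀ x ∈ l, x ∈ X) ↔
        ∃ w l', (g.foldl F (some l, w)).1 = some l' ∧ ∀ x ∈ l', x ∈ X := by
      intro g
      induction g with
      | nil => intro l; simp
      | cons b g ih =>
        intro l
        constructor
        · rintro ⟨h1, h2⟩
          obtain ⟨w, m, e1, e2⟩ := (h b X).1 (h1 b (by simp))
          obtain ⟨w', l', e3, e4⟩ := (ih (m ++ l)).1 ⟨fun c hc => h1 c (by simp [hc]), by
            intro x hx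
            rcases List.mem_append.1 hx with hx | hx
            · exact e2 x hx
            · exact h2 x hx⟩
          refine ⟨Nat.pair w w', l', ?_, e4⟩
          rw [List.foldl_cons]
          simpa [F, e1] using e3
        · rintro ⟨w, l', e3, e4⟩
          rw [List.foldl_cons] at e3
          cases hm : L (b, w.unpair.1) with
          | none =>
            have : F (some l, w) b = (none, w.unpair.2) := by simp [F, hm]
            rw [this, none_fold] at e3
            cases e3
          | some m =>
            have : F (some l, w) b = (some (m ++ l), w.unpair.2) := by simp [F, hm]
            rw [this] at e3
            obtain ⟨k1, k2⟩ := (ih (m ++ l)).2 ⟨_, _, e3, e4⟩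
            refine ⟨?_, fun x hx => k2 x (by simp [hx])⟩
            intro c hc
            rcases List.mem_cons.1 hc with rfl | hc
            · exact (h _ _).2 ⟨_, _, hm, fun x hx => k2 x (by simp [hx])⟩
            · exact k1 c hc
    simpa using key g []

/-- Parametrised composition. -/
theorem EPos.comp {P : α → Set ℕ → Prop} {Q : α × ℕ → Set ℕ → Prop} (hP : EPos P) (hQ : EPos Q) :
    EPos (fun a X => P a {b | Q (a, b) X}) := by
  obtain ⟨L, hL, h⟩ := hP
  obtain ⟨M, hM, k⟩ := hQ.ball
  refine ⟨fun q => (L (q.1, q.2.unpair.1)).bind fun l =>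
    M (l.map (fun b => (q.1, b)), q.2.unpair.2), ?_, fun a X => ?_⟩
  · refine Primrec.option_bind (hL.comp (Primrec.fst.pair
      (Primrec.fst.comp (Primrec.unpair.comp Primrec.snd)))) ?_
    refine hM.comp (Primrec.pair ?_
      (Primrec.snd.comp (Primrec.unpair.comp (Primrec.snd.comp Primrec.fst))))
    exact Primrec.list_map Primrec.snd
      (Primrec.pair (Primrec.fst.comp (Primrec.fst.comp Primrec.fst)) Primrec.snd)
  · beta_reduce
    rw [h]
    constructor
    · rintro ⟨w, l, h1, h2⟩
      obtain ⟨w', l', h3, h4⟩ := (k (l.map (fun b => (a, b))) X).1 (by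
        intro b hb
        obtain ⟨c, hc, rfl⟩ := List.mem_map.1 hb
        exact h2 c hc)
      exact ⟨Nat.pair w w', l', by simp [h1, h3], h4⟩
    · rintro ⟨w, l, h1, h2⟩
      simp only [Option.bind_eq_some_iff] at h1
      obtain ⟨l1, e1, e2⟩ := h1
      refine ⟨_, _, e1, fun b hb => ?_⟩
      exact (k _ X).2 ⟨_, _, e2, h2⟩ (a, b) (List.mem_map.2 ⟨b, hb, rfl⟩)

/-- Uniform iteration of an enumeration operator. -/
theorem EPos.iter {Φ : Set ℕ → Set ℕ} (hΦ : EPos (fun n X => n ∈ Φ X)) :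
    EPos (fun (p : ℕ × ℕ) X => p.2 ∈ Φ^[p.1] X) := by
  obtain ⟨M, hM, k⟩ := hΦ.ball
  let F : Option (List ℕ) × ℕ → Option (List ℕ) × ℕ := fun s =>
    (s.1.bind fun l => M (l, s.2.unpair.1), s.2.unpair.2)
  refine ⟨fun q => (F^[q.1.1] (some [q.1.2], q.2)).1, ?_, ?_⟩
  · refine Primrec.fst.comp ?_
    refine Primrec.nat_iterate (h := fun _ s => F s) (Primrec.fst.comp Primrec.fst) (Primrec.pair ?_ Primrec.snd) ?_
    · exact Primrec.option_some.comp (Primrec.list_cons.comp (Primrec.snd.comp Primrec.fst)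
        (Primrec.const []))
    · have e1 : Primrec fun x : ((ℕ × ℕ) × ℕ) × (Option (List ℕ) × ℕ) => x.2.2.unpair :=
        Primrec.unpair.comp (Primrec.snd.comp Primrec.snd)
      refine Primrec.pair ?_ (Primrec.snd.comp e1)
      refine Primrec.option_bind (Primrec.fst.comp Primrec.snd) ?_
      exact hM.comp (Primrec.pair Primrec.snd ((Primrec.fst.comp e1).comp Primrec.fst))
  · have none_it : ∀ (j : ℕ) (w : ℕ), (F^[j] (none, w)).1 = none := by
      intro j
      induction j with
      | zero => intro w; rfl
      | succ j ih => intro w; exact ih _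
    have key : ∀ (X : Set ℕ) (j : ℕ) (l : List ℕ), (∀ b ∈ l, b ∈ Φ^[j] X) ↔
        ∃ w l', (F^[j] (some l, w)).1 = some l' ∧ ∀ x ∈ l', x ∈ X := by
      intro X j
      induction j with
      | zero => intro l; simp
      | succ j ih =>
        intro l
        rw [Function.iterate_succ', Function.comp_apply]
        refine (k l (Φ^[j] X)).trans ?_
        constructor
        · rintro ⟨w, l', h1, h2⟩
          obtain ⟨w', l'', h3, h4⟩ := (ih l').1 h2
          refine ⟨Nat.pair w w', l'', ?_, h4⟩
          rw [Function.iterate_succ, Function.comp_apply]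
          simpa [F, h1] using h3
        · rintro ⟨w, l'', h3, h4⟩
          rw [Function.iterate_succ, Function.comp_apply] at h3
          cases hm : M (l, w.unpair.1) with
          | none =>
            have : F (some l, w) = (none, w.unpair.2) := by simp [F, hm]
            rw [this, none_it] at h3
            cases h3
          | some m =>
            have : F (some l, w) = (some m, w.unpair.2) := by simp [F, hm]
            rw [this] at h3
            exact ⟨_, _, hm, (ih m).2 ⟨_, _, h3, h4⟩⟩
    rintro ⟨j, n⟩ X
    simpa using key X j [n]

theorem primrec_testBit_s15 : PrimrecRel (fun x u : ℕ => Nat.testBit u x = true) := by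
  have hpow : Primrec fun x : ℕ => 2 ^ x := by
    refine (Primrec.nat_iterate (f := fun x : ℕ => x) (g := fun _ => 1) (h := fun _ y => 2 * y)
      Primrec.id (Primrec.const 1) (Primrec.nat_mul.comp (Primrec.const 2) Primrec.snd)).of_eq ?_
    intro x
    induction x with
    | zero => rfl
    | succ x ih => rw [Function.iterate_succ', Function.comp_apply, ih, pow_succ]; ring
  have : PrimrecRel (fun x u : ℕ => u / 2 ^ x % 2 = 1) :=
    Primrec.eq.comp (Primrec.nat_mod.comp (Primrec.nat_div.comp Primrec.snd
      (hpow.comp Primrec.fst)) (Primrec.const 2)) (Primrec.const 1)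
  refine this.of_eq ?_
  intro x u
  rw [Nat.testBit_eq_decide_div_mod_eq]
  simp

/-- The universal enumeration operator. -/
theorem EPos.univ : EPos (fun (p : ℕ × ℕ) X => p.2 ∈ eOp p.1 X) := by
  let bits : ℕ → List ℕ := fun u => (List.range u).filter (fun x => Nat.testBit u x)
  have hb : ∀ u x, x ∈ bits u ↔ x ∈ finCode u := by
    intro u x
    simp only [bits, finCode, List.mem_filter, List.mem_range, Set.mem_ofPred_eq]
    constructor
    · exact fun h => h.2
    · intro h
      exact ⟨lt_of_lt_of_le Nat.lt_two_pow_self (Nat.ge_two_pow_of_testBit h), h⟩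
  have hbits : Primrec bits := by
    have := (primrec_testBit_s15.listFilter).comp Primrec.list_range Primrec.id
    refine this.of_eq ?_
    intro u
    simp [bits]
  refine ⟨fun q => if (Nat.Partrec.Code.evaln q.2.unpair.2 (Denumerable.ofNat Nat.Partrec.Code q.1.1)
      (Nat.pair q.1.2 q.2.unpair.1)).isSome = true then some (bits q.2.unpair.1) else none, ?_, ?_⟩
  · have e1 : Primrec fun q : (ℕ × ℕ) × ℕ => q.2.unpair := Primrec.unpair.comp Primrec.snd
    refine Primrec.ite ?_ (Primrec.option_some.comp (hbits.comp (Primrec.fst.comp e1)))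
      (Primrec.const none)
    refine Primrec.eq.comp (Primrec.option_isSome.comp ?_) (Primrec.const true)
    refine Nat.Partrec.Code.primrec_evaln.comp (Primrec.pair (Primrec.pair (Primrec.snd.comp e1)
      ((Primrec.ofNat _).comp (Primrec.fst.comp Primrec.fst))) ?_)
    exact Primrec₂.natPair.comp (Primrec.snd.comp Primrec.fst) (Primrec.fst.comp e1)
  · rintro ⟨i, n⟩ X
    constructor
    · rintro ⟨u, h1, h2⟩
      obtain ⟨y, hy⟩ := Part.dom_iff_mem.1 h1
      obtain ⟨s, hs⟩ := Nat.Partrec.Code.evaln_complete.1 hy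
      refine ⟨Nat.pair u s, bits u, ?_, fun x hx => h2 ((hb u x).1 hx)⟩
      simp [Option.mem_def.1 hs]
    · rintro ⟨w, l, h1, h2⟩
      by_cases hs : (Nat.Partrec.Code.evaln w.unpair.2 (Denumerable.ofNat Nat.Partrec.Code i)
        (Nat.pair n w.unpair.1)).isSome = true
      · simp only [hs, if_true] at h1
        obtain rfl := Option.some.inj h1
        obtain ⟨y, hy⟩ := Option.isSome_iff_exists.1 hs
        refine ⟨w.unpair.1, ?_, fun x hx => h2 x ((hb _ x).2 hx)⟩
        exact Part.dom_iff_mem.2 ⟨y, Nat.Partrec.Code.evaln_sound hy⟩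
      · simp [hs] at h1

theorem EPos.eop (i : ℕ) {f : α → ℕ} (hf : Primrec f) : EPos (fun a X => f a ∈ eOp i X) :=
  EPos.univ.subst (f := fun a => (i, f a)) ((Primrec.const i).pair hf)

theorem exists_code_list (l : List ℕ) : ∃ u, ∀ x, Nat.testBit u x = true ↔ x ∈ l := by
  induction l with
  | nil => exact ⟨0, by simp⟩
  | cons y l ih =>
    obtain ⟨u, hu⟩ := ih
    refine ⟨u ||| 2 ^ y, fun x => ?_⟩
    rw [Nat.testBit_or, Nat.testBit_two_pow, Bool.or_eq_true, hu]
    simp only [decide_eq_true_eq, List.mem_cons]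
    tauto

theorem EPos.index {P : ℕ → Set ℕ → Prop} (hP : EPos P) : ∃ i, ∀ X, {n | P n X} = eOp i X := by
  obtain ⟨L, hL, h⟩ := hP
  let T : ℕ → ℕ → Option Bool := fun m w => (L (m.unpair.1, w)).map fun l =>
    decide (∀ x ∈ l, Nat.testBit m.unpair.2 x = true)
  have hT : Primrec₂ T := by
    have e1 : Primrec fun q : ℕ × ℕ => q.1.unpair := Primrec.unpair.comp Primrec.fst
    refine Primrec.option_map (hL.comp (Primrec.pair (Primrec.fst.comp e1) Primrec.snd)) ?_
    have := primrec_testBit_s15.forall_mem_list.decide.comp (Primrec.snd (α := ℕ × ℕ) (β := List ℕ))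
      ((Primrec.snd.comp e1).comp Primrec.fst)
    exact this
  have hR : Nat.Partrec (fun m => Nat.rfind (fun w => Part.some ((T m w).getD false))) := by
    refine Partrec.nat_iff.1 ?_
    refine Partrec.rfind ?_
    exact (Primrec.option_getD.comp hT (Primrec.const false)).to_comp
  obtain ⟨c, hc⟩ := Nat.Partrec.Code.exists_code.1 hR
  refine ⟨Encodable.encode c, fun X => ?_⟩
  have hce : ∀ m, m ∈ ceSet (Encodable.encode c) ↔ ∃ w l, L (m.unpair.1, w) = some l ∧
      ∀ x ∈ l, Nat.testBit m.unpair.2 x = true := by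
    intro m
    simp only [ceSet, Denumerable.ofNat_encode, hc, Set.mem_ofPred_eq]
    refine Nat.rfind_dom.trans ?_
    constructor
    · rintro ⟨w, hw, -⟩
      rw [Part.mem_some_iff] at hw
      cases hl : L (m.unpair.1, w) with
      | none => simp [T, hl] at hw
      | some l => exact ⟨w, l, hl, by simpa [T, hl] using hw⟩
    · rintro ⟨w, l, hl, hx⟩
      refine ⟨w, ?_, fun {m} _ => trivial⟩
      rw [Part.mem_some_iff]
      simpa [T, hl] using hx
  ext n
  simp only [Set.mem_ofPred_eq, h, eOp, hce]
  constructor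
  · rintro ⟨w, l, h1, h2⟩
    obtain ⟨u, hu⟩ := exists_code_list l
    refine ⟨u, ⟨w, l, by simpa using h1, by simpa using fun x hx => (hu x).2 hx⟩, ?_⟩
    intro x hx
    exact h2 x ((hu x).1 hx)
  · rintro ⟨u, ⟨w, l, h1, h2⟩, h3⟩
    simp only [Nat.unpair_pair] at h1 h2
    exact ⟨w, l, h1, fun x hx => h3 (h2 x hx)⟩

end machinery

theorem EPos.comp' {α : Type} [Primcodable α] {P : α → Set ℕ → Prop} {Φ : α → Set ℕ → Set ℕ}
    (hP : EPos P) (hΦ : EPos (fun (p : α × ℕ) X => p.2 ∈ Φ p.1 X)) :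
    EPos (fun a X => P a (Φ a X)) := by
  refine (hP.comp hΦ).congr fun a X => ?_
  have : {b | b ∈ Φ a X} = Φ a X := by ext b; simp
  simp only [this]

theorem ELe.refl' (A : Set ℕ) : ELe A A := by
  obtain ⟨i, hi⟩ := (EPos.mem (α := ℕ) Primrec.id).index
  refine ⟨i, ?_⟩
  rw [ELeVia, ← hi A]
  ext n; simp

theorem ELe.trans' {A B C : Set ℕ} (h1 : ELe A B) (h2 : ELe B C) : ELe A C := by
  obtain ⟨i, rfl⟩ := h1
  obtain ⟨j, rfl⟩ := h2
  obtain ⟨k, hk⟩ := ((EPos.eop (α := ℕ) i Primrec.id).comp' (Φ := fun _ X => eOp j X)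
    (EPos.eop j Primrec.snd)).index
  refine ⟨k, ?_⟩
  rw [ELeVia, ← hk C]
  ext n; simp

theorem EEquiv.trans' {A B C : Set ℕ} (h1 : EEquiv A B) (h2 : EEquiv B C) : EEquiv A C :=
  ⟨h1.1.trans' h2.1, h2.2.trans' h1.2⟩

theorem EEquivVia.equiv {A B : Set ℕ} {i j : ℕ} (h : EEquivVia A B i j) : EEquiv A B :=
  ⟨⟨i, h.1⟩, ⟨j, h.2⟩⟩

theorem mem_eJoin (A B : Set ℕ) (n : ℕ) :
    n ∈ eJoin A B ↔ (n % 2 = 0 ∧ n / 2 ∈ A) ∨ (n % 2 = 1 ∧ n / 2 ∈ B) := by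
  simp only [eJoin, Set.mem_ofPred_eq]
  constructor
  · rintro (⟨m, hm, rfl⟩ | ⟨m, hm, rfl⟩)
    · left; exact ⟨by omega, by rwa [show 2 * m / 2 = m by omega]⟩
    · right; exact ⟨by omega, by rwa [show (2 * m + 1) / 2 = m by omega]⟩
  · rintro (⟨h, hm⟩ | ⟨h, hm⟩)
    · left; exact ⟨_, hm, by omega⟩
    · right; exact ⟨_, hm, by omega⟩

theorem even_mem_eJoin (A B : Set ℕ) (n : ℕ) : 2 * n ∈ eJoin A B ↔ n ∈ A := by
  rw [mem_eJoin, show 2 * n / 2 = n by omega]; simp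

theorem odd_mem_eJoin (A B : Set ℕ) (n : ℕ) : 2 * n + 1 ∈ eJoin A B ↔ n ∈ B := by
  rw [mem_eJoin, show (2 * n + 1) / 2 = n by omega]
  have : (2 * n + 1) % 2 = 1 := by omega
  simp [this]

theorem pr_half : Primrec fun n : ℕ => n / 2 := Primrec.nat_div.comp Primrec.id (Primrec.const 2)

theorem pr_parity (c : ℕ) : PrimrecPred fun n : ℕ => n % 2 = c :=
  Primrec.eq.comp (Primrec.nat_mod.comp Primrec.id (Primrec.const 2)) (Primrec.const c)

theorem pr_double : Primrec fun n : ℕ => 2 * n := Primrec.nat_mul.comp (Primrec.const 2) Primrec.id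

theorem pr_odd : Primrec fun n : ℕ => 2 * n + 1 := Primrec.succ.comp pr_double

theorem setOf_odd_eJoin (A B : Set ℕ) : {n | 2 * n + 1 ∈ eJoin A B} = B := by
  ext n; simp [odd_mem_eJoin]

theorem setOf_even_eJoin (A B : Set ℕ) : {n | 2 * n ∈ eJoin A B} = A := by
  ext n; simp [even_mem_eJoin]

/-- Applying the `i`-th operator to the right half. -/
theorem EPos.eopR {α : Type} [Primcodable α] (i : ℕ) {f : α → ℕ} (hf : Primrec f) :
    EPos (fun a X => f a ∈ eOp i {n | 2 * n + 1 ∈ X}) :=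
  (EPos.eop i hf).comp (Q := fun p X => 2 * p.2 + 1 ∈ X) (EPos.mem (pr_odd.comp Primrec.snd))

theorem EPos.eopL {α : Type} [Primcodable α] (i : ℕ) {f : α → ℕ} (hf : Primrec f) :
    EPos (fun a X => f a ∈ eOp i {n | 2 * n ∈ X}) :=
  (EPos.eop i hf).comp (Q := fun p X => 2 * p.2 ∈ X) (EPos.mem (pr_double.comp Primrec.snd))

theorem pad_zero : ∃ i j, ∀ Z, EEquivVia Z (eJoin {0} Z) i j := by
  obtain ⟨i, hi⟩ := (EPos.mem (α := ℕ) pr_odd).index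
  obtain ⟨j, hj⟩ := ((EPos.dec (α := ℕ) (Primrec.eq.comp Primrec.id (Primrec.const 0))).or
    ((EPos.dec (pr_parity 1)).and (EPos.mem pr_half))).index
  refine ⟨i, j, fun Z => ⟨?_, ?_⟩⟩
  · rw [ELeVia, ← hi]
    exact (setOf_odd_eJoin _ _).symm
  · rw [ELeVia, ← hj]
    ext n
    rw [mem_eJoin]
    simp only [Set.mem_ofPred_eq, Set.mem_singleton_iff, id]
    have : (n % 2 = 0 ∧ n / 2 = 0) ↔ n = 0 := by omega
    rw [this]

theorem shift_one : ∃ i j, ∀ a Z, EEquivVia (eJoin {a} Z) (eJoin {a + 1} Z) i j := by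
  obtain ⟨i, hi⟩ := (((EPos.dec (pr_parity 1)).and (EPos.mem (α := ℕ) Primrec.id)).or
    ((EPos.dec (pr_parity 0)).and (EPos.mem (Primrec.succ.comp Primrec.succ)))).index
  obtain ⟨j, hj⟩ := (((EPos.dec (pr_parity 1)).and (EPos.mem (α := ℕ) Primrec.id)).or
    ((EPos.dec (pr_parity 0)).and ((EPos.dec (Primrec.nat_le.comp (Primrec.const 2) Primrec.id)).and
      (EPos.mem (Primrec.nat_sub.comp Primrec.id (Primrec.const 2)))))).index
  refine ⟨i, j, fun a Z => ⟨?_, ?_⟩⟩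
  · rw [ELeVia, ← hi]
    ext n
    simp only [Set.mem_ofPred_eq, mem_eJoin, Set.mem_singleton_iff, id]
    by_cases h : n % 2 = 0
    · have e : ¬ n % 2 = 1 := by omega
      have e2 : ¬ n.succ.succ % 2 = 1 := by omega
      simp only [h, e, e2, false_and, or_false, true_and, false_or]
      omega
    · have e : n % 2 = 1 := by omega
      simp [e]
  · rw [ELeVia, ← hj]
    ext n
    simp only [Set.mem_ofPred_eq, mem_eJoin, Set.mem_singleton_iff, id]
    by_cases h : n % 2 = 0
    · have e : ¬ n % 2 = 1 := by omega
      have e2 : ¬ (n - 2) % 2 = 1 := by omega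
      simp only [h, e, e2, false_and, or_false, true_and, false_or]
      omega
    · have e : n % 2 = 1 := by omega
      simp [e]

theorem pad_equiv (a : ℕ) (Z : Set ℕ) : EEquiv Z (eJoin {a} Z) := by
  induction a with
  | zero =>
    obtain ⟨i, j, h⟩ := pad_zero
    exact (h Z).equiv
  | succ a ih =>
    obtain ⟨i, j, h⟩ := shift_one
    exact ih.trans' (h a Z).equiv

/-- The set that is `D` when `a ∈ Q` and `C` otherwise (for `C ⊆ D`). -/
def swFam (Q C D : Set ℕ) (a : ℕ) : Set ℕ := {x | x ∈ C ∨ (x ∈ D ∧ a ∈ Q)}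

theorem swFam_pos {Q C D : Set ℕ} {a : ℕ} (h : C ⊆ D) (ha : a ∈ Q) : swFam Q C D a = D := by
  ext x; simp only [swFam, Set.mem_ofPred_eq]
  exact ⟨fun k => k.elim (fun k => h k) (fun k => k.1), fun k => Or.inr ⟨k, ha⟩⟩

theorem swFam_neg {Q C D : Set ℕ} {a : ℕ} (ha : a ∉ Q) : swFam Q C D a = C := by
  ext x; simp [swFam, ha]

theorem fam_via {A Q C D : Set ℕ} {g : ℕ} (hQ : ELe Q A) (hC : ELe C A) (hD : ELe D A)
    (hgC : A = eOp g C) (hgD : A = eOp g D) (hCD : C ⊆ D) :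
    ∃ i j, ∀ a, EEquivVia (eJoin {a} (swFam Q C D a)) (eJoin {a} A) i j := by
  obtain ⟨q, hq⟩ := hQ
  obtain ⟨c, hc⟩ := hC
  obtain ⟨d, hd⟩ := hD
  obtain ⟨i, hi⟩ := (((EPos.dec (pr_parity 0)).and (EPos.mem (α := ℕ) Primrec.id)).or
    ((EPos.dec (pr_parity 1)).and ((EPos.eopR c pr_half).or ((EPos.eopR d pr_half).and
      (EPos.ex (P := fun p X => 2 * p.2 ∈ X ∧ p.2 ∈ eOp q {n | 2 * n + 1 ∈ X})
        ((EPos.mem (pr_double.comp Primrec.snd)).and (EPos.eopR q Primrec.snd))))))).index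
  obtain ⟨j, hj⟩ := (((EPos.dec (pr_parity 0)).and (EPos.mem (α := ℕ) Primrec.id)).or
    ((EPos.dec (pr_parity 1)).and (EPos.eopR g pr_half))).index
  refine ⟨i, j, fun a => ⟨?_, ?_⟩⟩
  · rw [ELeVia, ← hi, setOf_odd_eJoin]
    rw [ELeVia] at hq hc hd
    rw [← hq, ← hc, ← hd]
    ext n
    simp only [Set.mem_ofPred_eq, even_mem_eJoin, Set.mem_singleton_iff, id]
    rw [mem_eJoin, mem_eJoin]
    simp only [swFam, Set.mem_ofPred_eq, Set.mem_singleton_iff, exists_eq_left]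
    by_cases h : n % 2 = 0
    · simp [h]
    · have e : n % 2 = 1 := by omega
      simp [e]
  · have hg : eOp g (swFam Q C D a) = A := by
      by_cases ha : a ∈ Q
      · rw [swFam_pos hCD ha, ← hgD]
      · rw [swFam_neg ha, ← hgC]
    rw [ELeVia, ← hj, setOf_odd_eJoin, hg]
    ext n
    simp only [Set.mem_ofPred_eq, id]
    rw [mem_eJoin, mem_eJoin]
    by_cases h : n % 2 = 0
    · simp [h]
    · have e : n % 2 = 1 := by omega
      simp [e]

theorem fam_le {A Q C D : Set ℕ} {g : ℕ} {f : Set ℕ → Set ℕ}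
    (hf : UniformlyEInvariantOn (edeg A) f)
    (hQ : ELe Q A) (hC : ELe C A) (hD : ELe D A)
    (hgC : A = eOp g C) (hgD : A = eOp g D) (hCD : C ⊆ D) (n : ℕ) :
    ELe {a | n ∈ f (swFam Q C D a)} (f A) := by
  obtain ⟨u, hu⟩ := hf
  obtain ⟨z1, z2, hz⟩ := pad_zero
  obtain ⟨s1, s2, hs⟩ := shift_one
  obtain ⟨t1, t2, ht⟩ := fam_via hQ hC hD hgC hgD hCD
  have hA : A ∈ edeg A := ⟨ELe.refl' A, ELe.refl' A⟩
  have hpad : ∀ a, ∀ Z ∈ edeg A, eJoin {a} Z ∈ edeg A := fun a Z hZ =>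
    EEquiv.trans' hZ (pad_equiv a Z)
  have hfam : ∀ a, swFam Q C D a ∈ edeg A := by
    intro a
    by_cases ha : a ∈ Q
    · rw [swFam_pos hCD ha]; exact ⟨⟨g, hgD⟩, hD⟩
    · rw [swFam_neg ha]; exact ⟨⟨g, hgC⟩, hC⟩
  generalize hS1 : (u (Nat.pair s1 s2)).unpair.1 = S1
  generalize hS2 : (u (Nat.pair s1 s2)).unpair.2 = S2
  have it : ∀ Z ∈ edeg A, ∀ a, f (eJoin {0} Z) = (eOp S1)^[a] (f (eJoin {a} Z)) ∧
      f (eJoin {a} Z) = (eOp S2)^[a] (f (eJoin {0} Z)) := by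
    intro Z hZ a
    induction a with
    | zero => exact ⟨rfl, rfl⟩
    | succ a ih =>
      obtain ⟨k1, k2⟩ := hu _ (hpad a Z hZ) _ (hpad (a + 1) Z hZ) _ _ (hs a Z)
      rw [ELeVia, hS1] at k1
      rw [ELeVia, hS2] at k2
      rw [Function.iterate_succ, Function.comp_apply, ← k1, Function.iterate_succ',
        Function.comp_apply, ← ih.2]
      exact ⟨ih.1, k2⟩
  have hz' : ∀ Z ∈ edeg A, _ := fun Z hZ => hu _ hZ _ (hpad 0 Z hZ) _ _ (hz Z)
  have ht' := fun a => hu _ (hpad a _ (hfam a)) _ (hpad a A hA) _ _ (ht a)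
  generalize (u (Nat.pair z1 z2)).unpair.1 = Z1 at hz'
  generalize (u (Nat.pair z1 z2)).unpair.2 = Z2 at hz'
  generalize (u (Nat.pair t1 t2)).unpair.1 = T1 at ht'
  have key : ∀ a, f (swFam Q C D a) =
      eOp Z1 ((eOp S1)^[a] (eOp T1 ((eOp S2)^[a] (eOp Z2 (f A))))) := by
    intro a
    have e1 := (hz' A hA).2
    have e2 := (it A hA a).2
    have e3 := (ht' a).1
    have e4 := (it _ (hfam a) a).1
    have e5 := (hz' _ (hfam a)).1
    rw [ELeVia] at e1 e3 e5
    rw [← e1, ← e2, ← e3, ← e4, ← e5]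
  have p1 : EPos (fun (p : ℕ × ℕ) X => p.2 ∈ (eOp S2)^[p.1] (eOp Z2 X)) :=
    (EPos.iter (Φ := eOp S2) (EPos.eop S2 Primrec.id)).comp' (Φ := fun _ X => eOp Z2 X)
      (EPos.eop Z2 Primrec.snd)
  have p2 : EPos (fun (p : ℕ × ℕ) X => p.2 ∈ eOp T1 ((eOp S2)^[p.1] (eOp Z2 X))) :=
    (EPos.eop T1 Primrec.snd).comp' (Φ := fun p X => (eOp S2)^[p.1] (eOp Z2 X))
      (p1.subst (f := fun r : (ℕ × ℕ) × ℕ => (r.1.1, r.2))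
        ((Primrec.fst.comp Primrec.fst).pair Primrec.snd))
  have p3 : EPos (fun (p : ℕ × ℕ) X =>
      p.2 ∈ (eOp S1)^[p.1] (eOp T1 ((eOp S2)^[p.1] (eOp Z2 X)))) :=
    (EPos.iter (Φ := eOp S1) (EPos.eop S1 Primrec.id)).comp'
      (Φ := fun p X => eOp T1 ((eOp S2)^[p.1] (eOp Z2 X)))
      (p2.subst (f := fun r : (ℕ × ℕ) × ℕ => (r.1.1, r.2))
        ((Primrec.fst.comp Primrec.fst).pair Primrec.snd))
  have p4 : EPos (fun (a : ℕ) X =>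
      n ∈ eOp Z1 ((eOp S1)^[a] (eOp T1 ((eOp S2)^[a] (eOp Z2 X))))) :=
    (EPos.eop Z1 (Primrec.const n)).comp'
      (Φ := fun a X => (eOp S1)^[a] (eOp T1 ((eOp S2)^[a] (eOp Z2 X)))) p3
  obtain ⟨i, hi⟩ := p4.index
  refine ⟨i, ?_⟩
  rw [ELeVia, ← hi]
  ext a
  simp only [Set.mem_ofPred_eq, key]

theorem KPair.restrict {U A B S : Set ℕ} (h : KPair U A B) (hS : ELe S B) :
    ∃ v, (∀ a ∈ A, ∀ c ∈ S, Nat.pair a c ∈ eOp v U) ∧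
      (∀ a ∉ A, ∀ c ∉ S, Nat.pair a c ∉ eOp v U) := by
  obtain ⟨W, hW, h1, h2⟩ := h
  obtain ⟨s, hs⟩ := hS
  obtain ⟨i, hi⟩ := ((EPos.eop (α := ℕ) s (Primrec.snd.comp Primrec.unpair)).comp
    (Q := fun p X => Nat.pair p.1.unpair.1 p.2 ∈ X) (EPos.mem (Primrec₂.natPair.comp
      (Primrec.fst.comp (Primrec.unpair.comp Primrec.fst)) Primrec.snd))).index
  have hV : ELe (eOp i W) W := ⟨i, rfl⟩
  obtain ⟨v, hv⟩ := hV.trans' hW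
  rw [ELeVia] at hv hs
  have mono : ∀ (X Y : Set ℕ), X ⊆ Y → eOp s X ⊆ eOp s Y := by
    rintro X Y h n ⟨u, hu1, hu2⟩
    exact ⟨u, hu1, hu2.trans h⟩
  have hm : ∀ a c, Nat.pair a c ∈ eOp v U ↔ c ∈ eOp s {b | Nat.pair a b ∈ W} := by
    intro a c
    rw [← hv, ← hi]
    simp
  refine ⟨v, fun a ha c hc => ?_, fun a ha c hc => ?_⟩
  · rw [hm]
    rw [hs] at hc
    exact mono _ _ (fun b hb => h1 a ha b hb) hc
  · rw [hm]
    intro h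
    apply hc
    rw [hs]
    refine mono _ _ (fun b hb => ?_) h
    by_contra hb'
    exact h2 a ha b hb' hb

theorem not_A_le {U A B : Set ℕ} (hK : NontrivialKPair U A B) : ¬ ELe A B := by
  intro h
  obtain ⟨v, h1, h2⟩ := hK.1.restrict h
  apply hK.2.1
  obtain ⟨i, hi⟩ := (EPos.eop (α := ℕ) v (Primrec₂.natPair.comp Primrec.id Primrec.id)).index
  refine ⟨i, ?_⟩
  rw [ELeVia, ← hi]
  ext a
  simp only [Set.mem_ofPred_eq, id]
  exact ⟨fun ha => h1 a ha a ha, fun h => by_contra fun ha => h2 a ha a ha h⟩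

/-- A diagonal set, reducible to `U`. -/
def diagSet (U : Set ℕ) : Set ℕ := {c | Nat.pair c.unpair.1 c ∈ eOp c.unpair.2 U}

theorem diagSet_le (U : Set ℕ) : ELe (diagSet U) U := by
  obtain ⟨i, hi⟩ := (EPos.univ.subst (f := fun c : ℕ => (c.unpair.2, Nat.pair c.unpair.1 c))
    ((Primrec.snd.comp Primrec.unpair).pair (Primrec₂.natPair.comp
      (Primrec.fst.comp Primrec.unpair) Primrec.id))).index
  refine ⟨i, ?_⟩
  rw [ELeVia, ← hi]
  rfl

theorem not_diag_le {U A B : Set ℕ} (hK : NontrivialKPair U A B) :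
    ¬ ELe {c | c ∉ diagSet U} B := by
  intro h
  obtain ⟨v, h1, h2⟩ := hK.1.restrict h
  apply hK.2.1
  obtain ⟨i, hi⟩ := (EPos.eop (α := ℕ) v (Primrec₂.natPair.comp Primrec.id
    (Primrec₂.natPair.comp Primrec.id (Primrec.const v)))).index
  refine ⟨i, ?_⟩
  rw [ELeVia, ← hi]
  ext a
  have hd : Nat.pair a v ∈ diagSet U ↔ Nat.pair a (Nat.pair a v) ∈ eOp v U := by
    simp [diagSet]
  simp only [Set.mem_ofPred_eq, id]
  constructor
  · intro ha
    by_contra hc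
    exact hc (h1 a ha (Nat.pair a v) (by
      simp only [Set.mem_ofPred_eq]
      rwa [hd]))
  · intro hc
    by_contra ha
    refine h2 a ha (Nat.pair a v) ?_ hc
    simp only [Set.mem_ofPred_eq, not_not]
    exact hd.2 hc

theorem step_eq {A B U C D : Set ℕ} {g : ℕ} {f : Set ℕ → Set ℕ}
    (hK : NontrivialKPair U A B) (hUA : ELe U A)
    (hf : UniformlyEInvariantOn (edeg A) f) (hfA : EEquiv (f A) B)
    (hC : ELe C A) (hD : ELe D A)
    (hgC : A = eOp g C) (hgD : A = eOp g D) (hCD : C ⊆ D) : f C = f D := by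
  ext n
  constructor
  · intro h1
    by_contra h2
    have := fam_le hf ((diagSet_le U).trans' hUA) hC hD hgC hgD hCD n
    apply not_diag_le hK
    refine ELe.trans' ?_ hfA.1
    convert this using 1
    ext c
    simp only [Set.mem_ofPred_eq]
    by_cases hc : c ∈ diagSet U
    · rw [swFam_pos hCD hc]; simp [hc, h2]
    · rw [swFam_neg hc]; simp [hc, h1]
  · intro h1
    by_contra h2
    have := fam_le hf (ELe.refl' A) hC hD hgC hgD hCD n
    apply not_A_le hK
    refine ELe.trans' ?_ hfA.1
    convert this using 1
    ext c
    simp only [Set.mem_ofPred_eq]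
    by_cases hc : c ∈ A
    · rw [swFam_pos hCD hc]; simp [hc, h1]
    · rw [swFam_neg hc]; simp [hc, h2]

theorem eJoin_le {A X Y : Set ℕ} (hX : ELe X A) (hY : ELe Y A) : ELe (eJoin X Y) A := by
  obtain ⟨x, hx⟩ := hX
  obtain ⟨y, hy⟩ := hY
  obtain ⟨i, hi⟩ := (((EPos.dec (pr_parity 0)).and (EPos.eop (α := ℕ) x pr_half)).or
    ((EPos.dec (pr_parity 1)).and (EPos.eop y pr_half))).index
  refine ⟨i, ?_⟩
  rw [ELeVia] at *
  rw [← hi, ← hx, ← hy]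
  ext n
  rw [mem_eJoin]
  simp

theorem empty_le (A : Set ℕ) : ELe ∅ A := by
  obtain ⟨i, hi⟩ := (EPos.dec (α := ℕ) (p := fun _ => False) (Primrec.primrecPred
    (by simpa using Primrec.const false))).index
  refine ⟨i, ?_⟩
  rw [ELeVia, ← hi]
  ext n; simp

theorem right_op (x : ℕ) : ∃ g, ∀ X Y, eOp g (eJoin X Y) = eOp x Y := by
  obtain ⟨i, hi⟩ := (EPos.eopR (α := ℕ) x Primrec.id).index
  refine ⟨i, fun X Y => ?_⟩
  rw [← hi, setOf_odd_eJoin]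
  ext n; simp

theorem left_op (x : ℕ) : ∃ g, ∀ X Y, eOp g (eJoin X Y) = eOp x X := by
  obtain ⟨i, hi⟩ := (EPos.eopL (α := ℕ) x Primrec.id).index
  refine ⟨i, fun X Y => ?_⟩
  rw [← hi, setOf_even_eJoin]
  ext n; simp

theorem pad_empty : ∃ i j, ∀ Z, EEquivVia Z (eJoin Z ∅) i j := by
  obtain ⟨i, hi⟩ := (EPos.mem (α := ℕ) pr_double).index
  obtain ⟨j, hj⟩ := ((EPos.dec (pr_parity 0)).and (EPos.mem pr_half)).index
  refine ⟨i, j, fun Z => ⟨?_, ?_⟩⟩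
  · rw [ELeVia, ← hi]
    exact (setOf_even_eJoin _ _).symm
  · rw [ELeVia, ← hj]
    ext n
    rw [mem_eJoin]
    simp

theorem pad_const {A B U : Set ℕ} {f : Set ℕ → Set ℕ}
    (hK : NontrivialKPair U A B) (hUA : ELe U A)
    (hf : UniformlyEInvariantOn (edeg A) f) (hfA : EEquiv (f A) B)
    {X : Set ℕ} (hX : X ∈ edeg A) : f (eJoin X ∅) = f (eJoin ∅ A) := by
  obtain ⟨⟨x, hx⟩, hXA⟩ := hX
  obtain ⟨r, hr⟩ := ELe.refl' A
  rw [ELeVia] at hx hr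
  obtain ⟨g, hg⟩ := left_op x
  obtain ⟨k, hk⟩ := right_op r
  have hA := ELe.refl' A
  have h1 : f (eJoin X ∅) = f (eJoin X A) := by
    refine step_eq (g := g) hK hUA hf hfA (eJoin_le hXA (empty_le A)) (eJoin_le hXA hA)
      (by rw [hg, ← hx]) (by rw [hg, ← hx]) ?_
    intro n
    simp only [mem_eJoin]
    simp
    tauto
  have h2 : f (eJoin ∅ A) = f (eJoin X A) := by
    refine step_eq (g := k) hK hUA hf hfA (eJoin_le (empty_le A) hA) (eJoin_le hXA hA)
      (by rw [hk, ← hr]) (by rw [hk, ← hr]) ?_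
    intro n
    simp only [mem_eJoin]
    simp
    tauto
  rw [h1, h2]

/-- If `{A, B}` is a nontrivial `K_U`-pair and `U <ₑ A`, then every uniformly
e-invariant `f` on `deg_e(A)` with `f(A) ≡ₑ B` is constant on `deg_e(A)`. -/
theorem kpair_forces_constant (A B U : Set ℕ)
    (hK : NontrivialKPair U A B) (hUA : ELt U A)
    (f : Set ℕ → Set ℕ) (hf : UniformlyEInvariantOn (edeg A) f)
    (hfA : EEquiv (f A) B) :
    ∀ X ∈ edeg A, ∀ Y ∈ edeg A, f X = f Y := by
  obtain ⟨i, j, hp⟩ := pad_empty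
  intro X hX Y hY
  have hX' := pad_const hK hUA.1 hf hfA hX
  have hY' := pad_const hK hUA.1 hf hfA hY
  obtain ⟨u, hu⟩ := hf
  have h1 := (hu X hX _ (EEquiv.trans' hX (hp X).equiv) i j (hp X)).1
  have h2 := (hu Y hY _ (EEquiv.trans' hY (hp Y).equiv) i j (hp Y)).1
  rw [ELeVia] at h1 h2
  rw [h1, h2, hX', hY']
end
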